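/- Let T be a triangulated category with arbitrary small coproducts and P a compact generator of T. Suppose that the graded endomorphism ring Λ = End_T(P)_* is N-sparse for some natural number N ≥ 2 and that the graded global homological dimension of Λ is equal to 1. Then T is equivalent, as a category, to the derived category D(Λ) of differential graded right Λ-modules. -/

import Mathlib

/-!
Shared setup: a triangulated category `C` with (co)products, a compact generator `P`,
the graded endomorphism ring `Λ = End_T(P)_* = Hom_T(Σ^* P, P)` and its category of
graded right modules, realized concretely.
-/

set_option linter.unusedSectionVars false

open CategoryTheory CategoryTheory.Limits CategoryTheory.Pretriangulated DirectSum

universe v u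

namespace Franke

variable {C : Type u} [Category.{v} C] [Preadditive C] [HasZeroObject C]
  [HasShift C ℤ] [∀ n : ℤ, (shiftFunctor C n).Additive] [Pretriangulated C]

/-- The degree `k` component of the graded endomorphism ring
`Λ = End_T(P)_* = Hom_T(Σ^* P, P)`: its degree `k` part is `Hom(P⟦k⟧, P)`. -/
abbrev lam (P : C) (k : ℤ) : Type v := (P⟦k⟧ ⟶ P)

/-- The right action of a degree `k` element `a : Σᵏ P ⟶ P` of `Λ` on a degree `n`
element `m : Σⁿ P ⟶ X` of the graded hom `π_* X = Hom_T(Σ^* P, X)`; the result is the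
degree `n + k` element `Σ^{n+k} P ≅ (Σᵏ P)⟦n⟧ → Σⁿ P → X`. -/
def gsmulHom (P : C) {X : C} {n k l : ℤ} (h : n + k = l)
    (m : P⟦n⟧ ⟶ X) (a : lam P k) : P⟦l⟧ ⟶ X :=
  (shiftFunctorAdd' C k n l (by omega)).hom.app P ≫ a⟦n⟧' ≫ m

/-- The multiplication of the graded endomorphism ring `Λ = End_T(P)_*`. -/
def gmul (P : C) {j k l : ℤ} (h : j + k = l) (a : lam P j) (b : lam P k) : lam P l :=
  gsmulHom P h a b

/-- The unit `1 ∈ Λ₀ = Hom(Σ⁰P, P)` of the graded endomorphism ring. -/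
def gone (P : C) : lam P 0 := (shiftFunctorZero C ℤ).hom.app P

/-- A ℤ-graded right module over the graded endomorphism ring `Λ = End_T(P)_*`.
The action is indexed by proofs `n + k = l` in order to avoid transport along
equalities of degrees. -/
structure GradedModule (P : C) where
  M : ℤ → Type v
  [acg : ∀ n, AddCommGroup (M n)]
  smul : ∀ {n k l : ℤ}, n + k = l → M n → lam P k → M l
  smul_addₓ : ∀ {n k l : ℤ} (h : n + k = l) (m : M n) (a b : lam P k),
    smul h m (a + b) = smul h m a + smul h m b
  add_smulₓ : ∀ {n k l : ℤ} (h : n + k = l) (m m' : M n) (a : lam P k),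
    smul h (m + m') a = smul h m a + smul h m' a
  smul_oneₓ : ∀ {n : ℤ} (m : M n), smul (add_zero n) m (gone P) = m
  smul_mulₓ : ∀ {n j k nj jk njk : ℤ} (h₁ : n + j = nj) (h₂ : j + k = jk)
    (h₃ : nj + k = njk) (h₄ : n + jk = njk) (m : M n) (a : lam P j) (b : lam P k),
    smul h₃ (smul h₁ m a) b = smul h₄ m (gmul P h₂ a b)

attribute [instance] GradedModule.acg

/-- The action of a fixed `a : Λₖ` as an additive map `Mₙ →+ M_{n+k}`. -/
def GradedModule.smulAddHom {P : C} (M : GradedModule P) {n k l : ℤ} (h : n + k = l)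
    (a : lam P k) : M.M n →+ M.M l :=
  AddMonoidHom.mk' (fun m => M.smul h m a) (fun m m' => M.add_smulₓ h m m' a)

theorem GradedModule.zero_smulₓ {P : C} (M : GradedModule P) {n k l : ℤ} (h : n + k = l)
    (a : lam P k) : M.smul h (0 : M.M n) a = 0 :=
  map_zero (M.smulAddHom h a)

/-- `π_* X = Hom_T(Σ^* P, X)` as a graded right `Λ`-module. -/
@[reducible] def piMod (P X : C) : GradedModule P where
  M n := P⟦n⟧ ⟶ X
  smul h m a := gsmulHom P h m a
  smul_addₓ h m a b := by
    simp [gsmulHom, Functor.map_add, Preadditive.comp_add, Preadditive.add_comp]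
  add_smulₓ h m m' a := by
    simp [gsmulHom, Preadditive.comp_add]
  smul_oneₓ m := by
    simp only [gsmulHom, gone]
    rw [shiftFunctorAdd'_zero_add_hom_app, ← Functor.map_comp_assoc, Iso.inv_hom_id_app]
    simp
  smul_mulₓ {n j k nj jk njk} h₁ h₂ h₃ h₄ m a b := by
    simp only [gsmulHom, gmul, Functor.map_comp, Category.assoc]
    have nat := ((shiftFunctorAdd' C j n nj (by omega)).hom).naturality b
    dsimp at nat
    rw [reassoc_of% nat]
    rw [← shiftFunctorAdd'_assoc_hom_app_assoc k j n jk nj njk (by omega) (by omega)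
      (by omega) P]


/-- A morphism of graded right `Λ`-modules: a degree-preserving `Λ`-linear additive map. -/
structure GHom {P : C} (M N : GradedModule P) where
  app : ∀ n : ℤ, M.M n →+ N.M n
  app_smul : ∀ {n k l : ℤ} (h : n + k = l) (m : M.M n) (a : lam P k),
    app l (M.smul h m a) = N.smul h (app n m) a

@[ext] theorem GHom.ext {P : C} {M N : GradedModule P} {f g : GHom M N}
    (h : ∀ (n : ℤ) (x : M.M n), f.app n x = g.app n x) : f = g := by
  obtain ⟨fa, _⟩ := f; obtain ⟨ga, _⟩ := g
  congr 1
  funext n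
  exact AddMonoidHom.ext (h n)

/-- The identity morphism of graded modules. -/
def GHom.id {P : C} (M : GradedModule P) : GHom M M :=
  ⟨fun _ => AddMonoidHom.id _, fun _ _ _ => rfl⟩

/-- Composition of morphisms of graded modules. -/
def GHom.comp {P : C} {M N K : GradedModule P} (g : GHom N K) (f : GHom M N) : GHom M K :=
  ⟨fun n => (g.app n).comp (f.app n), fun h m a => by
    simp only [AddMonoidHom.comp_apply, f.app_smul, g.app_smul]⟩

instance {P : C} {M N : GradedModule P} : Zero (GHom M N) :=
  ⟨{ app := fun _ => 0
     app_smul := fun h m a => by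
       show (0 : N.M _) = N.smul h (0 : N.M _) a
       exact (N.zero_smulₓ h a).symm }⟩

@[simp] theorem GHom.zero_app {P : C} {M N : GradedModule P} (n : ℤ) (x : M.M n) :
    (0 : GHom M N).app n x = 0 := rfl

/-- An isomorphism of graded right `Λ`-modules. -/
structure GIso {P : C} (M N : GradedModule P) where
  hom : GHom M N
  inv : GHom N M
  hom_inv_id : inv.comp hom = GHom.id M
  inv_hom_id : hom.comp inv = GHom.id N

/-- The shift `M[k]` of a graded module, with `M[k]ₙ = M_{n-k}`. -/
@[reducible] def gshift {P : C} (k : ℤ) (M : GradedModule P) : GradedModule P where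
  M n := M.M (n - k)
  smul h m a := M.smul (by omega) m a
  smul_addₓ h m a b := M.smul_addₓ _ m a b
  add_smulₓ h m m' a := M.add_smulₓ _ m m' a
  smul_oneₓ m := M.smul_oneₓ m
  smul_mulₓ h₁ h₂ h₃ h₄ m a b := M.smul_mulₓ _ h₂ _ _ m a b

/-- Surjectivity (in each degree) of a morphism of graded modules. -/
def GHom.Surj {P : C} {M N : GradedModule P} (f : GHom M N) : Prop :=
  ∀ n : ℤ, Function.Surjective (f.app n)

/-- A pair of composable morphisms of graded modules `0 → Z → E → B → 0`
forming a short exact sequence. -/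
structure IsShortExact {P : C} {Z E B : GradedModule P} (ι : GHom Z E) (ρ : GHom E B) : Prop where
  mono : ∀ n : ℤ, Function.Injective (ι.app n)
  epi : ∀ n : ℤ, Function.Surjective (ρ.app n)
  exact : ∀ (n : ℤ) (x : E.M n), ρ.app n x = 0 ↔ x ∈ Set.range (ι.app n)

/-- Exactness of `M → N → K` at `N` (including that the composite vanishes). -/
def ExactPair {P : C} {M N K : GradedModule P} (f : GHom M N) (g : GHom N K) : Prop :=
  ∀ (n : ℤ) (x : N.M n), g.app n x = 0 ↔ x ∈ Set.range (f.app n)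

/-- A graded module is projective if every degreewise surjection onto it splits against
any map from it: the usual lifting property. -/
def IsProjective {P : C} (Q : GradedModule P) : Prop :=
  ∀ (A B : GradedModule P) (e : GHom A B), e.Surj →
    ∀ f : GHom Q B, ∃ g : GHom Q A, e.comp g = f

/-- `projDimLE d M` says that the graded module `M` admits a projective resolution of
length at most `d`, i.e. has projective dimension `≤ d`. -/
def projDimLE {P : C} : ℕ → GradedModule P → Prop
  | 0, M => IsProjective M
  | d + 1, M => ∃ (F K : GradedModule P) (ε : GHom F M) (ι : GHom K F),
      IsProjective F ∧ IsShortExact ι ε ∧ projDimLE d K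

/-- `Λ = End_T(P)_*` is `N`-sparse: concentrated in degrees divisible by `N`. -/
def Sparse (P : C) (N : ℕ) : Prop :=
  ∀ k : ℤ, ¬ ((N : ℤ) ∣ k) → ∀ a : lam P k, a = 0

/-- A graded module belongs to `B[i]`: it is concentrated in degrees congruent
to `i` modulo `N`. -/
def InDegrees {P : C} (N : ℕ) (i : ZMod N) (M : GradedModule P) : Prop :=
  ∀ n : ℤ, (n : ZMod N) ≠ i → ∀ x : M.M n, x = 0

/-- The canonical comparison map `⊕ᵢ Hom(P, Xᵢ) → Hom(P, ∐ᵢ Xᵢ)`. -/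
noncomputable def compactComparison [HasCoproducts.{v} C] (P : C) {ι : Type v} (X : ι → C) :
    (⨁ i, (P ⟶ X i)) →+ (P ⟶ ∐ X) := by
  classical
  exact DirectSum.toAddMonoid fun i =>
    AddMonoidHom.mk' (fun f => f ≫ Sigma.ι X i) (fun f g => Preadditive.add_comp _ _ _ _ _ _)

/-- `P` is a compact object: `Hom(P, −)` commutes with small coproducts. -/
def IsCompactObj [HasCoproducts.{v} C] (P : C) : Prop :=
  ∀ (ι : Type v) (X : ι → C), Function.Bijective (compactComparison P X)

/-- `P` is a generator: an object all of whose graded homs from `P` vanish is zero. -/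
def IsGenerator (P : C) : Prop :=
  ∀ X : C, (∀ (n : ℤ) (f : P⟦n⟧ ⟶ X), f = 0) → IsZero X

/-- The morphism of graded modules `π_* f : π_* X → π_* Y` induced by `f : X ⟶ Y`. -/
def piGHom (P : C) {X Y : C} (f : X ⟶ Y) : GHom (piMod P X) (piMod P Y) where
  app n := AddMonoidHom.mk' (fun u => u ≫ f) fun u v => Preadditive.add_comp _ _ _ _ _ _
  app_smul h m a := by
    show (gsmulHom P h m a) ≫ f = gsmulHom P h (m ≫ f) a
    simp [gsmulHom]

/-- An extension of `B` by `Z` in the category of graded right `Λ`-modules: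
  a short exact sequence `0 → Z → E → B → 0`. -/
structure GExtension {P : C} (B Z : GradedModule P) where
  E : GradedModule P
  ι : GHom Z E
  ρ : GHom E B
  shortExact : IsShortExact ι ρ

/-- Two extensions are identified if there is a morphism of extensions between them
(such a morphism is automatically an isomorphism). -/
def GExtension.Rel {P : C} {B Z : GradedModule P} (e e' : GExtension B Z) : Prop :=
  ∃ φ : GHom e.E e'.E, φ.comp e.ι = e'.ι ∧ e'.ρ.comp φ = e.ρ

/-- `Ext¹_Λ(B, Z)`, realized as the set of equivalence classes of extensions
`0 → Z → E → B → 0` of graded right `Λ`-modules. -/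
def Ext1 {P : C} (B Z : GradedModule P) : Type _ :=
  Quot (GExtension.Rel (B := B) (Z := Z))

/-- Given `δ : Cc ⟶ ΣX`, the induced morphism of graded modules
`π_* Cc → (π_* X)[1]`, using the canonical identification `π_*(ΣX) ≅ (π_*X)[1]`. -/
noncomputable def triangleConnect (P : C) {X Cc : C} (δ : Cc ⟶ X⟦(1:ℤ)⟧) :
    GHom (piMod P Cc) (gshift 1 (piMod P X)) where
  app n := AddMonoidHom.mk' (fun u =>
    (shiftFunctorAdd' C n (-1) (n-1) (by omega)).hom.app P ≫ (u ≫ δ)⟦(-1:ℤ)⟧' ≫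
      (shiftFunctorCompIsoId C (1:ℤ) (-1) (by omega)).hom.app X) (fun u v => by
        simp [Preadditive.add_comp, Preadditive.comp_add, Functor.map_add])
  app_smul {n k l} h m a := by
    simp only [AddMonoidHom.mk'_apply]
    show (shiftFunctorAdd' C l (-1) (l-1) (by omega)).hom.app P ≫
        ((gsmulHom P h m a) ≫ δ)⟦(-1:ℤ)⟧' ≫
          (shiftFunctorCompIsoId C (1:ℤ) (-1) (by omega)).hom.app X =
      gsmulHom P (show (n-1) + k = l - 1 by omega)
        ((shiftFunctorAdd' C n (-1) (n-1) (by omega)).hom.app P ≫ (m ≫ δ)⟦(-1:ℤ)⟧' ≫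
          (shiftFunctorCompIsoId C (1:ℤ) (-1) (by omega)).hom.app X) a
    simp only [gsmulHom, Functor.map_comp, Category.assoc]
    have nat := ((shiftFunctorAdd' C n (-1) (n-1) (by omega : n + -1 = n - 1)).hom).naturality a
    dsimp at nat
    rw [reassoc_of% nat]
    rw [shiftFunctorAdd'_assoc_hom_app_assoc k n (-1) l (n-1) (l-1) (by omega) (by omega)
      (by omega) P]

section ExtGroups

instance {P : C} {M N : GradedModule P} : Add (GHom M N) :=
  ⟨fun f g =>
    { app := fun n => f.app n + g.app n
      app_smul := fun {n k l} h m a => by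
        show f.app l _ + g.app l _ = N.smul h (f.app n m + g.app n m) a
        rw [f.app_smul, g.app_smul, N.add_smulₓ] }⟩

instance {P : C} {M N : GradedModule P} : Neg (GHom M N) :=
  ⟨fun f =>
    { app := fun n => -(f.app n)
      app_smul := fun {n k l} h m a => by
        show -(f.app l _) = N.smul h (-(f.app n m)) a
        rw [f.app_smul]
        exact (map_neg (N.smulAddHom h a) _).symm }⟩

@[simp] theorem GHom.add_app {P : C} {M N : GradedModule P} (f g : GHom M N) (n : ℤ)
    (x : M.M n) : (f + g).app n x = f.app n x + g.app n x := rfl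

@[simp] theorem GHom.neg_app {P : C} {M N : GradedModule P} (f : GHom M N) (n : ℤ)
    (x : M.M n) : (-f).app n x = -(f.app n x) := rfl

instance {P : C} {M N : GradedModule P} : AddCommGroup (GHom M N) where
  add := (· + ·)
  zero := 0
  neg := Neg.neg
  add_assoc f g h := by ext n x; simp [add_assoc]
  zero_add f := by ext n x; simp
  add_zero f := by ext n x; simp
  add_comm f g := by ext n x; simp [add_comm]
  neg_add_cancel f := by ext n x; simp
  nsmul := nsmulRec
  zsmul := zsmulRec

/-- A projective resolution `⋯ → F₂ → F₁ → F₀ → B → 0` of a graded right `Λ`-module. -/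
structure ProjResolution {P : C} (B : GradedModule P) where
  F : ℕ → GradedModule P
  d : ∀ i : ℕ, GHom (F (i + 1)) (F i)
  aug : GHom (F 0) B
  projective : ∀ i, IsProjective (F i)
  aug_surjective : ∀ n : ℤ, Function.Surjective (aug.app n)
  exact_aug : ∀ (n : ℤ) (x : (F 0).M n), aug.app n x = 0 ↔ x ∈ Set.range ((d 0).app n)
  exact_d : ∀ (i : ℕ) (n : ℤ) (x : (F (i + 1)).M n),
    (d i).app n x = 0 ↔ x ∈ Set.range ((d (i + 1)).app n)

/-- The differential of the cochain complex `Hom_Λ(F_•, Z)` obtained by applying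
`Hom_Λ(−, Z)` to a projective resolution `F_•`. -/
def cochainD {P : C} {B : GradedModule P} (R : ProjResolution B) (Z : GradedModule P)
    (i : ℕ) : GHom (R.F i) Z →+ GHom (R.F (i + 1)) Z :=
  AddMonoidHom.mk' (fun f => f.comp (R.d i)) (fun f g => by ext n x; rfl)

/-- `Ext^{j+1}_Λ(B, Z)`, computed as the `(j+1)`-st cohomology
`ker(Hom(F_{j+1}, Z) → Hom(F_{j+2}, Z)) / im(Hom(F_j, Z) → Hom(F_{j+1}, Z))`
of the complex `Hom_Λ(F_•, Z)` for a projective resolution `F_• → B`. -/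
def extGroup {P : C} {B : GradedModule P} (R : ProjResolution B) (Z : GradedModule P)
    (j : ℕ) : Type v :=
  AddMonoidHom.ker (cochainD R Z (j + 1)) ⧸
    (AddMonoidHom.range (cochainD R Z j)).addSubgroupOf
      (AddMonoidHom.ker (cochainD R Z (j + 1)))

noncomputable instance {P : C} {B : GradedModule P} (R : ProjResolution B)
    (Z : GradedModule P) (j : ℕ) : AddCommGroup (extGroup R Z j) := by
  dsimp [extGroup]; infer_instance

end ExtGroups
section DG

/-- A differential graded right module over `Λ = End_T(P)_*`, where `Λ` is regarded as a
DG ring with zero differential: a graded right `Λ`-module together with a square-zero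
`Λ`-linear differential of degree `-1`. -/
structure DGMod (P : C) where
  gm : GradedModule P
  d : ∀ {n m : ℤ}, m + 1 = n → (gm.M n →+ gm.M m)
  d_sq : ∀ {n m j : ℤ} (h : m + 1 = n) (h' : j + 1 = m) (x : gm.M n), d h' (d h x) = 0
  d_smul : ∀ {n m j l l' : ℤ} (h : m + 1 = n) (hl : n + j = l) (hl' : l' + 1 = l)
    (hm : m + j = l') (x : gm.M n) (a : lam P j),
    d hl' (gm.smul hl x a) = gm.smul hm (d h x) a

/-- A morphism of DG `Λ`-modules: a morphism of the underlying graded modules commuting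
with the differentials. -/
structure DGHom {P : C} (M N : DGMod P) where
  g : GHom M.gm N.gm
  comm : ∀ {n m : ℤ} (h : m + 1 = n) (x : M.gm.M n),
    g.app m (M.d h x) = N.d h (g.app n x)

@[ext] theorem DGHom.ext {P : C} {M N : DGMod P} {f f' : DGHom M N}
    (h : ∀ (n : ℤ) (x : M.gm.M n), f.g.app n x = f'.g.app n x) : f = f' := by
  obtain ⟨fg, _⟩ := f; obtain ⟨fg', _⟩ := f'
  congr 1
  exact GHom.ext h

/-- The category of differential graded right `Λ`-modules. -/
instance dgModCategory (P : C) : Category (DGMod P) where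
  Hom M N := DGHom M N
  id M := ⟨GHom.id _, fun _ _ => rfl⟩
  comp f g := ⟨g.g.comp f.g, fun h x => by
    show g.g.app _ (f.g.app _ _) = _
    rw [f.comm, g.comm]
    rfl⟩
  id_comp f := by apply DGHom.ext; intros; rfl
  comp_id f := by apply DGHom.ext; intros; rfl
  assoc f g h := by apply DGHom.ext; intros; rfl

/-- The cycles `ker dₙ` of a DG module in degree `n`. -/
abbrev cycles {P : C} (M : DGMod P) (n : ℤ) : AddSubgroup (M.gm.M n) :=
  AddMonoidHom.ker (M.d (n := n) (m := n - 1) (by omega))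

/-- The boundaries `im d_{n+1}` of a DG module in degree `n`. -/
abbrev boundaries {P : C} (M : DGMod P) (n : ℤ) : AddSubgroup (M.gm.M n) :=
  AddMonoidHom.range (M.d (n := n + 1) (m := n) rfl)

/-- The homology `H_n M = ker dₙ / im d_{n+1}` of a DG module. -/
abbrev dgHomology {P : C} (M : DGMod P) (n : ℤ) : Type v :=
  cycles M n ⧸ (boundaries M n).addSubgroupOf (cycles M n)

/-- The map induced on cycles by a morphism of DG modules. -/
def cyclesMap {P : C} {M N : DGMod P} (f : M ⟶ N) (n : ℤ) : cycles M n →+ cycles N n :=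
  AddMonoidHom.codRestrict ((f.g.app n).comp (cycles M n).subtype) _ (fun x => by
    have hx : M.d (show (n - 1) + 1 = n by omega) x.1 = 0 := x.2
    have : N.d (show (n - 1) + 1 = n by omega) (f.g.app n x.1) = 0 := by
      rw [← f.comm (show (n - 1) + 1 = n by omega), hx, map_zero]
    exact this)

/-- The map induced on homology by a morphism of DG modules. -/
def dgHomologyMap {P : C} {M N : DGMod P} (f : M ⟶ N) (n : ℤ) :
    dgHomology M n →+ dgHomology N n :=
  QuotientAddGroup.map _ _ (cyclesMap f n) (by
    intro x hx
    have hx' : x.1 ∈ boundaries M n := hx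
    obtain ⟨y, hy⟩ := AddMonoidHom.mem_range.mp hx'
    have : (f.g.app n x.1) ∈ boundaries N n := by
      refine AddMonoidHom.mem_range.mpr ⟨f.g.app (n + 1) y, ?_⟩
      rw [← f.comm rfl y, hy]
    exact this)

/-- A quasi-isomorphism of DG modules: a morphism inducing an isomorphism on homology. -/
def quasiIso (P : C) : MorphismProperty (DGMod P) :=
  fun _ _ f => ∀ n : ℤ, Function.Bijective (dgHomologyMap f n)

/-- The derived category `D(Λ)` of the graded endomorphism ring `Λ = End_T(P)_*`
(regarded as a DG ring with zero differential): the localization of the category of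
DG right `Λ`-modules at the quasi-isomorphisms. -/
abbrev DerivedCat (P : C) := (quasiIso P).Localization

end DG


section Localization

universe v₁ u₁ v₂ u₂ v₃ u₃

/-- Two full and essentially surjective functors out of the same category which identify the
same morphisms have equivalent targets. -/
theorem nonempty_equivalence_of_full_essSurj {E : Type u₁} [Category.{v₁} E]
    {D₁ : Type u₂} [Category.{v₂} D₁] {D₂ : Type u₃} [Category.{v₃} D₂]
    (G₁ : E ⥤ D₁) (G₂ : E ⥤ D₂) [G₁.Full] [G₁.EssSurj] [G₂.Full] [G₂.EssSurj]
    (h : ∀ {X Y : E} (f g : X ⟶ Y), G₁.map f = G₁.map g ↔ G₂.map f = G₂.map g) :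
    Nonempty (D₁ ≌ D₂) := by
  have hrel : G₁.homRel = G₂.homRel := by
    funext X Y f g
    exact propext (h f g)
  let e₁ := (CategoryTheory.Quotient.lift G₁.homRel G₁ (fun _ _ _ _ h => h)).asEquivalence
  let e₂ := (CategoryTheory.Quotient.lift G₂.homRel G₂ (fun _ _ _ _ h => h)).asEquivalence
  rw [← hrel] at e₂
  exact ⟨e₁.symm.trans e₂⟩

variable {D : Type u₁} [Category.{v₁} D] (W : MorphismProperty D) (X₀ : D)
  (r : ∀ M : D, (X₀ ⟶ M) → (X₀ ⟶ M) → Prop)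
  (hcomp : ∀ {M N : D} (g : M ⟶ N) (a b : X₀ ⟶ M), r M a b → r N (a ≫ g) (b ≫ g))

/-- The functor sending `M` to the quotient of `Hom(X₀, M)` by a relation stable under
postcomposition. -/
def quotHom : D ⥤ Type (max u₁ v₁) where
  obj M := ULift.{u₁} (Quot (r M))
  map g := TypeCat.ofHom fun x => ⟨Quot.map (fun a => a ≫ g) (hcomp g) x.down⟩
  map_id M := by
    ext ⟨x⟩
    induction x using Quot.ind
    simp [Quot.map]
  map_comp f g := by
    ext ⟨x⟩
    induction x using Quot.ind
    simp [Quot.map]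

theorem quotHom_map_mk {M N : D} (g : M ⟶ N) (a : X₀ ⟶ M) :
    (quotHom X₀ r hcomp).map g ⟨Quot.mk _ a⟩ = ⟨Quot.mk _ (a ≫ g)⟩ := rfl

theorem localization_hom_of_quotHom_bijective
    (hbij : ∀ {M N : D} (g : M ⟶ N), W g →
      Function.Bijective (Quot.map (fun a => a ≫ g) (hcomp g)))
    (hQ : ∀ {M : D} (a b : X₀ ⟶ M), r M a b → W.Q.map a = W.Q.map b) (M : D) :
    (∀ φ : W.Q.obj X₀ ⟶ W.Q.obj M, ∃ a : X₀ ⟶ M, W.Q.map a = φ) ∧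
      ∀ a b : X₀ ⟶ M, W.Q.map a = W.Q.map b → Quot.mk (r M) a = Quot.mk (r M) b := by
  have hinv : W.IsInvertedBy (quotHom X₀ r hcomp) := by
    intro M N g hg
    rw [isIso_iff_bijective]
    obtain ⟨h1, h2⟩ := hbij g hg
    constructor
    · rintro ⟨x⟩ ⟨y⟩ hxy
      exact congrArg ULift.up (h1 (congrArg ULift.down hxy))
    · rintro ⟨y⟩
      obtain ⟨x, rfl⟩ := h2 y
      exact ⟨⟨x⟩, rfl⟩
  let H := Localization.Construction.lift (quotHom X₀ r hcomp) hinv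
  have hfac : W.Q ⋙ H = quotHom X₀ r hcomp := Localization.Construction.fac _ _
  have hmap : ∀ {M N : D} (g : M ⟶ N) (x : H.obj (W.Q.obj M)),
      H.map (W.Q.map g) x = (quotHom X₀ r hcomp).map g x := by
    intro M N g x
    have := Functor.congr_hom hfac g
    simp only [Functor.comp_map] at this
    exact congrArg (fun t => t x) this
  let τ : W.Q ⋙ H ⟶ W.Q ⋙ coyoneda.obj (Opposite.op (W.Q.obj X₀)) :=
    { app := fun M => TypeCat.ofHom fun (x : (quotHom X₀ r hcomp).obj M) =>
        Quot.lift (fun a : X₀ ⟶ M => W.Q.map a) (fun a b h => hQ a b h) x.down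
      naturality := by
        intro M N g
        ext x
        obtain ⟨x⟩ := x
        induction x using Quot.ind with | _ a =>
        have h1 := (hmap g ⟨Quot.mk _ a⟩).trans (quotHom_map_mk X₀ r hcomp g a)
        exact (congrArg (fun x : (quotHom X₀ r hcomp).obj N =>
          Quot.lift (fun a : X₀ ⟶ N => W.Q.map a) (fun a b h => hQ a b h) x.down) h1).trans
            (W.Q.map_comp a g) }
  let τ' := Localization.Construction.natTransExtension τ
  have hτ' : ∀ M, τ'.app (W.Q.obj M) = τ.app M := fun M =>
    Localization.Construction.NatTransExtension.app_eq τ M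
  let e : H.obj (W.Q.obj X₀) := (⟨Quot.mk _ (𝟙 X₀)⟩ : (quotHom X₀ r hcomp).obj X₀)
  constructor
  · intro φ
    have h1 := congrArg (fun t => t e) (τ'.naturality φ)
    have h2 : ∃ a : X₀ ⟶ M, H.map φ e = (⟨Quot.mk _ a⟩ : (quotHom X₀ r hcomp).obj M) := by
      obtain ⟨x, hx⟩ : ∃ x : (quotHom X₀ r hcomp).obj M, x = H.map φ e := ⟨_, rfl⟩
      obtain ⟨x⟩ := x
      induction x using Quot.ind with | _ a => exact ⟨a, hx.symm⟩
    obtain ⟨a, ha⟩ := h2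
    refine ⟨a, ?_⟩
    change τ'.app (W.Q.obj M) (H.map φ e) = τ'.app (W.Q.obj X₀) e ≫ φ at h1
    rw [ha, hτ', hτ'] at h1
    change W.Q.map a = W.Q.map (𝟙 X₀) ≫ φ at h1
    rw [h1, W.Q.map_id, Category.id_comp]
  · intro a b hab
    have h1 : H.map (W.Q.map a) e = H.map (W.Q.map b) e := by rw [hab]
    rw [hmap, hmap, quotHom_map_mk, quotHom_map_mk, Category.id_comp, Category.id_comp] at h1
    exact congrArg ULift.down h1

end Localization

section Graded

variable {P : C}

/-- Transport along an equality of degrees. -/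
def GradedModule.tr (M : GradedModule P) {n m : ℤ} (h : n = m) : M.M n →+ M.M m :=
  h ▸ AddMonoidHom.id _

@[simp] theorem GradedModule.tr_self (M : GradedModule P) {n : ℤ} (h : n = n) (x : M.M n) :
    M.tr h x = x := rfl

theorem GHom.congr_app {M N : GradedModule P} {f g : GHom M N} (h : f = g) {n : ℤ} (x : M.M n) :
    f.app n x = g.app n x := by rw [h]

/-- A homomorphism of graded right modules of degree `s`. -/
structure DegHom (M N : GradedModule P) (s : ℤ) where
  app : ∀ {n m : ℤ}, n + s = m → (M.M n →+ N.M m)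
  app_smul : ∀ {n k l n' l' : ℤ} (h : n + k = l) (h₁ : n + s = n') (h₂ : l + s = l')
    (h₃ : n' + k = l') (x : M.M n) (a : lam P k),
    app h₂ (M.smul h x a) = N.smul h₃ (app h₁ x) a

namespace DegHom

variable {M N K L : GradedModule P} {s t r : ℤ}

@[ext] theorem ext {f g : DegHom M N s}
    (h : ∀ {n m : ℤ} (hm : n + s = m) (x : M.M n), f.app hm x = g.app hm x) : f = g := by
  obtain ⟨fa, _⟩ := f; obtain ⟨ga, _⟩ := g
  congr 1
  funext n m hm
  exact AddMonoidHom.ext (h hm)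

theorem app_tr (f : DegHom M N s) {n n' m m' : ℤ} (hn : n = n') (hm : m = m') (h : n + s = m)
    (h' : n' + s = m') (x : M.M n) : f.app h' (M.tr hn x) = N.tr hm (f.app h x) := by
  subst hn hm; rfl

instance : Zero (DegHom M N s) :=
  ⟨{ app := fun _ => 0
     app_smul := fun _ _ _ h₃ _ a => (N.zero_smulₓ h₃ a).symm }⟩

instance : Add (DegHom M N s) :=
  ⟨fun f g =>
    { app := fun h => f.app h + g.app h
      app_smul := fun h h₁ h₂ h₃ x a => by
        simp only [AddMonoidHom.add_apply, N.add_smulₓ, f.app_smul h h₁ h₂ h₃,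
          g.app_smul h h₁ h₂ h₃] }⟩

instance : Neg (DegHom M N s) :=
  ⟨fun f =>
    { app := fun h => -f.app h
      app_smul := fun h h₁ h₂ h₃ x a => by
        simp only [AddMonoidHom.neg_apply, f.app_smul h h₁ h₂ h₃]
        exact (map_neg (N.smulAddHom h₃ a) _).symm }⟩

@[simp] theorem zero_app {n m : ℤ} (h : n + s = m) (x : M.M n) :
    (0 : DegHom M N s).app h x = 0 := rfl

@[simp] theorem add_app (f g : DegHom M N s) {n m : ℤ} (h : n + s = m) (x : M.M n) :
    (f + g).app h x = f.app h x + g.app h x := rfl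

@[simp] theorem neg_app (f : DegHom M N s) {n m : ℤ} (h : n + s = m) (x : M.M n) :
    (-f).app h x = -f.app h x := rfl

instance : AddCommGroup (DegHom M N s) where
  add := (· + ·)
  zero := 0
  neg := Neg.neg
  add_assoc f g h := by ext; simp [add_assoc]
  zero_add f := by ext; simp
  add_zero f := by ext; simp
  add_comm f g := by ext; simp [add_comm]
  neg_add_cancel f := by ext; simp
  nsmul := nsmulRec
  zsmul := zsmulRec

@[simp] theorem sub_app (f g : DegHom M N s) {n m : ℤ} (h : n + s = m) (x : M.M n) :
    (f - g).app h x = f.app h x - g.app h x := by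
  rw [sub_eq_add_neg, add_app, neg_app, sub_eq_add_neg]

/-- Precomposition with a morphism of graded modules. -/
def pre (f : GHom L M) (g : DegHom M N s) : DegHom L N s where
  app h := (g.app h).comp (f.app _)
  app_smul h h₁ h₂ h₃ x a := by
    simp only [AddMonoidHom.comp_apply, f.app_smul, g.app_smul h h₁ h₂ h₃]

@[simp] theorem pre_app (f : GHom L M) (g : DegHom M N s) {n m : ℤ} (h : n + s = m) (x : L.M n) :
    (pre f g).app h x = g.app h (f.app n x) := rfl

/-- Postcomposition with a morphism of graded modules. -/
def post (g : DegHom M N s) (f : GHom N L) : DegHom M L s where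
  app h := (f.app _).comp (g.app h)
  app_smul h h₁ h₂ h₃ x a := by
    simp only [AddMonoidHom.comp_apply, f.app_smul, g.app_smul h h₁ h₂ h₃]

@[simp] theorem post_app (g : DegHom M N s) (f : GHom N L) {n m : ℤ} (h : n + s = m) (x : M.M n) :
    (post g f).app h x = f.app m (g.app h x) := rfl

end DegHom

/-- The shifted graded module with degree `n` part `M_{n+s}`. -/
@[reducible] def gsh (s : ℤ) (M : GradedModule P) : GradedModule P where
  M n := M.M (n + s)
  smul h m a := M.smul (by omega) m a
  smul_addₓ h m a b := M.smul_addₓ _ m a b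
  add_smulₓ h m m' a := M.add_smulₓ _ m m' a
  smul_oneₓ m := M.smul_oneₓ m
  smul_mulₓ h₁ h₂ h₃ h₄ m a b := M.smul_mulₓ _ h₂ _ _ m a b

/-- A degree `s` homomorphism as a degree preserving one with shifted target. -/
def DegHom.toShift {M N : GradedModule P} {s : ℤ} (f : DegHom M N s) : GHom M (gsh s N) where
  app n := f.app rfl
  app_smul h x a := f.app_smul h rfl rfl _ x a

/-- A degree preserving homomorphism into a shift as a homomorphism of degree `s`. -/
def DegHom.ofShift {M N : GradedModule P} {s : ℤ} (f : GHom M (gsh s N)) : DegHom M N s where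
  app {n _} h := (N.tr h).comp (f.app n)
  app_smul h h₁ h₂ h₃ x a := by
    subst h₁ h₂
    exact f.app_smul h x a

/-- A morphism of graded modules as a homomorphism of degree zero. -/
def GHom.toDeg {M N : GradedModule P} (f : GHom M N) : DegHom M N 0 where
  app {n m} h := (N.tr (by omega)).comp (f.app n)
  app_smul {n k l n' l'} h h₁ h₂ h₃ x a := by
    obtain rfl : n = n' := by omega
    obtain rfl : l = l' := by omega
    exact f.app_smul h x a

/-- A homomorphism of degree zero as a morphism of graded modules. -/
def DegHom.toGHom {M N : GradedModule P} (f : DegHom M N 0) : GHom M N where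
  app n := f.app (add_zero n)
  app_smul h x a := f.app_smul h _ _ _ x a

/-- A family of subgroups stable under the action of `Λ`. -/
structure GSub (M : GradedModule P) where
  S : ∀ n : ℤ, AddSubgroup (M.M n)
  smul_mem : ∀ {n k l : ℤ} (h : n + k = l) {x : M.M n} (a : lam P k), x ∈ S n →
    M.smul h x a ∈ S l

/-- The graded module underlying a graded submodule. -/
@[reducible] def GSub.toMod {M : GradedModule P} (S : GSub M) : GradedModule P where
  M n := S.S n
  smul h x a := ⟨M.smul h x.1 a, S.smul_mem h a x.2⟩
  smul_addₓ h m a b := Subtype.ext (M.smul_addₓ h m.1 a b)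
  add_smulₓ h m m' a := Subtype.ext (M.add_smulₓ h m.1 m'.1 a)
  smul_oneₓ m := Subtype.ext (M.smul_oneₓ m.1)
  smul_mulₓ h₁ h₂ h₃ h₄ m a b := Subtype.ext (M.smul_mulₓ h₁ h₂ h₃ h₄ m.1 a b)

/-- The quotient of a graded module by a graded submodule. -/
@[reducible] def GSub.quot {M : GradedModule P} (S : GSub M) : GradedModule P where
  M n := M.M n ⧸ S.S n
  smul {n k l} h x a := QuotientAddGroup.map (S.S n) (S.S l) (M.smulAddHom h a)
    (fun _ hx => S.smul_mem h a hx) x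
  smul_addₓ h m a b := by
    induction m using QuotientAddGroup.induction_on with | _ m =>
    exact congrArg _ (M.smul_addₓ h m a b)
  add_smulₓ h m m' a := map_add _ _ _
  smul_oneₓ m := by
    induction m using QuotientAddGroup.induction_on with | _ m =>
    exact congrArg _ (M.smul_oneₓ m)
  smul_mulₓ h₁ h₂ h₃ h₄ m a b := by
    induction m using QuotientAddGroup.induction_on with | _ m =>
    exact congrArg _ (M.smul_mulₓ h₁ h₂ h₃ h₄ m a b)

/-- The projection onto a quotient module. -/
def GSub.proj {M : GradedModule P} (S : GSub M) : GHom M S.quot where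
  app n := QuotientAddGroup.mk' (S.S n)
  app_smul _ _ _ := rfl

theorem GSub.proj_eq_zero {M : GradedModule P} (S : GSub M) {n : ℤ} (x : M.M n) :
    S.proj.app n x = 0 ↔ x ∈ S.S n :=
  QuotientAddGroup.eq_zero_iff x

/-- The image of a morphism of graded modules. -/
def GHom.range {M N : GradedModule P} (f : GHom M N) : GSub N where
  S n := (f.app n).range
  smul_mem h x a := by
    rintro ⟨y, rfl⟩
    exact ⟨_, f.app_smul h y a⟩

theorem IsProjective.exists_lift {Q A B : GradedModule P} (hQ : IsProjective Q) (e : GHom A B)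
    (f : GHom Q B) (h : ∀ (n : ℤ) (x : Q.M n), ∃ y, e.app n y = f.app n x) :
    ∃ g : GHom Q A, ∀ (n : ℤ) (x : Q.M n), e.app n (g.app n x) = f.app n x := by
  let e' : GHom A e.range.toMod :=
    ⟨fun n => (e.app n).rangeRestrict, fun h x a => Subtype.ext (e.app_smul h x a)⟩
  let f' : GHom Q e.range.toMod :=
    ⟨fun n => (f.app n).codRestrict _ (h n), fun h x a => Subtype.ext (f.app_smul h x a)⟩
  obtain ⟨g, hg⟩ := hQ _ _ e' (fun n => (e.app n).rangeRestrict_surjective) f'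
  exact ⟨g, fun n x => congrArg Subtype.val (GHom.congr_app hg x)⟩

theorem IsProjective.exists_degHom_lift {Q A B : GradedModule P} (hQ : IsProjective Q)
    {s t a : ℤ} (hst : a + t = s) (e : DegHom A B t) (f : DegHom Q B s)
    (h : ∀ {n m l : ℤ} (hm : n + s = m) (hl : l + t = m) (x : Q.M n),
      ∃ y, e.app hl y = f.app hm x) :
    ∃ g : DegHom Q A a, ∀ {n m l : ℤ} (hm : n + s = m) (hl : n + a = l) (hl' : l + t = m)
      (x : Q.M n), e.app hl' (g.app hl x) = f.app hm x := by
  let e' : GHom (gsh a A) (gsh s B) :=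
    ⟨fun n => e.app (show (n + a) + t = n + s by omega),
      fun h x a => e.app_smul _ _ _ _ x a⟩
  obtain ⟨g, hg⟩ := hQ.exists_lift e' f.toShift (fun n x => h _ _ x)
  refine ⟨DegHom.ofShift g, ?_⟩
  intro n m l hm hl hl' x
  subst hm hl
  exact hg n x

end Graded

section DGTheory

variable {P : C}

/-- The differential of a DG module as a homomorphism of degree `-1`. -/
def DGMod.dd (M : DGMod P) : DegHom M.gm M.gm (-1) where
  app h := M.d (by omega)
  app_smul h h₁ h₂ h₃ x a := M.d_smul _ h _ h₃ x a

theorem DGMod.dd_dd (M : DGMod P) {n m l : ℤ} (h : n + -1 = m) (h' : m + -1 = l) (x : M.gm.M n) :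
    M.dd.app h' (M.dd.app h x) = 0 := M.d_sq _ _ x

theorem DGHom.comm_dd {M N : DGMod P} (f : M ⟶ N) {n m : ℤ} (h : n + -1 = m) (x : M.gm.M n) :
    f.g.app m (M.dd.app h x) = N.dd.app h (f.g.app n x) := f.comm _ x

@[simp] theorem dgMod_comp_app {M N L : DGMod P} (f : M ⟶ N) (g : N ⟶ L) (n : ℤ) (x : M.gm.M n) :
    (f ≫ g).g.app n x = g.g.app n (f.g.app n x) := rfl

theorem quasiIso_iff {M N : DGMod P} (f : M ⟶ N) : quasiIso P f ↔
    (∀ {n m l : ℤ} (h : n + -1 = m) (h' : l + -1 = n) (z : N.gm.M n), N.dd.app h z = 0 →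
      ∃ x, M.dd.app h x = 0 ∧ ∃ w, N.dd.app h' w = f.g.app n x - z) ∧
    (∀ {n m l : ℤ} (h : n + -1 = m) (h' : l + -1 = n) (x : M.gm.M n) (w : N.gm.M l),
      M.dd.app h x = 0 → N.dd.app h' w = f.g.app n x → ∃ v, M.dd.app h' v = x) := by
  constructor
  · intro hf
    constructor
    · intro n m l h h' z hz
      obtain rfl : n - 1 = m := by omega
      obtain rfl : n + 1 = l := by omega
      obtain ⟨x, hx⟩ := (hf n).2 (QuotientAddGroup.mk ⟨z, hz⟩)
      induction x using QuotientAddGroup.induction_on with | _ x =>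
      refine ⟨x.1, x.2, ?_⟩
      have h3 := QuotientAddGroup.eq.mp hx
      obtain ⟨y, hy⟩ := h3
      refine ⟨-y, ?_⟩
      rw [map_neg]
      refine (congrArg Neg.neg hy).trans ?_
      change -(-f.g.app n x.1 + z) = _
      abel
    · intro n m l h h' x w hx hw
      obtain rfl : n - 1 = m := by omega
      obtain rfl : n + 1 = l := by omega
      have h1 : dgHomologyMap f n (QuotientAddGroup.mk ⟨x, hx⟩) = dgHomologyMap f n 0 := by
        rw [map_zero]
        exact (QuotientAddGroup.eq_zero_iff _).mpr ⟨w, hw⟩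
      obtain ⟨v, hv⟩ := (QuotientAddGroup.eq_zero_iff _).mp ((hf n).1 h1)
      exact ⟨v, hv⟩
  · rintro ⟨h1, h2⟩ n
    constructor
    · rw [injective_iff_map_eq_zero]
      intro x hx
      induction x using QuotientAddGroup.induction_on with | _ x =>
      obtain ⟨w, hw⟩ := (QuotientAddGroup.eq_zero_iff _).mp hx
      obtain ⟨v, hv⟩ := h2 (show n + -1 = n - 1 by omega) (show n + 1 + -1 = n by omega) x.1 w
        x.2 hw
      exact (QuotientAddGroup.eq_zero_iff _).mpr ⟨v, hv⟩
    · intro z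
      induction z using QuotientAddGroup.induction_on with | _ z =>
      obtain ⟨x, hx, w, hw⟩ := h1 (show n + -1 = n - 1 by omega) (show n + 1 + -1 = n by omega)
        z.1 z.2
      refine ⟨QuotientAddGroup.mk ⟨x, hx⟩, QuotientAddGroup.eq.mpr ⟨-w, ?_⟩⟩
      rw [map_neg]
      refine (congrArg Neg.neg hw).trans ?_
      change -(f.g.app n x - z.1) = -f.g.app n x + z.1
      abel

/-- The product of two graded modules. -/
@[reducible] def GradedModule.prod (M N : GradedModule P) : GradedModule P where
  M n := M.M n × N.M n
  smul h x a := (M.smul h x.1 a, N.smul h x.2 a)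
  smul_addₓ h m a b := Prod.ext (M.smul_addₓ h _ a b) (N.smul_addₓ h _ a b)
  add_smulₓ h m m' a := Prod.ext (M.add_smulₓ h _ _ a) (N.add_smulₓ h _ _ a)
  smul_oneₓ m := Prod.ext (M.smul_oneₓ _) (N.smul_oneₓ _)
  smul_mulₓ h₁ h₂ h₃ h₄ m a b := Prod.ext (M.smul_mulₓ h₁ h₂ h₃ h₄ _ a b)
    (N.smul_mulₓ h₁ h₂ h₃ h₄ _ a b)

/-- The differential `(x, y) ↦ (dx, gx - dy)` of the mapping cone of `g`. -/
def coneD {M N : DGMod P} (g : M ⟶ N) :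
    DegHom (M.gm.prod (gsh 1 N.gm)) (M.gm.prod (gsh 1 N.gm)) (-1) where
  app {n m} h := AddMonoidHom.mk' (fun x => (M.dd.app h x.1,
      N.gm.tr (by omega) (g.g.app n x.1) - N.dd.app (by omega) x.2)) (by
    intro x y
    ext
    · exact map_add _ _ _
    · simp only [Prod.fst_add, Prod.snd_add, map_add]
      abel)
  app_smul {n k l n' l'} h h₁ h₂ h₃ x a := by
    obtain rfl : n' + 1 = n := by omega
    obtain rfl : l' + 1 = l := by omega
    refine Prod.ext (M.dd.app_smul h h₁ h₂ h₃ x.1 a) ?_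
    change g.g.app _ (M.gm.smul h x.1 a) - N.dd.app _ (N.gm.smul _ x.2 a) =
      N.gm.smul _ (g.g.app _ x.1 - N.dd.app _ x.2) a
    rw [g.g.app_smul, N.dd.app_smul (n' := n' + 1) (h₁ := by omega) (h₃ := by omega)]
    exact (map_sub (N.gm.smulAddHom _ a) _ _).symm

theorem exists_lift_of_quasiIso {M N : DGMod P} (g : M ⟶ N) (hg : quasiIso P g)
    {Q : GradedModule P} (hQ : IsProjective Q) {s t u : ℤ} (hst : s + 1 = t) (htu : t + 1 = u)
    (q : DegHom Q M.gm s) (r : DegHom Q N.gm t)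
    (hq : ∀ {n m l : ℤ} (h : n + s = m) (h' : m + -1 = l) (x : Q.M n),
      M.dd.app h' (q.app h x) = 0)
    (hr : ∀ {n m l : ℤ} (h : n + s = m) (h' : n + t = l) (h'' : l + -1 = m) (x : Q.M n),
      N.dd.app h'' (r.app h' x) = g.g.app m (q.app h x)) :
    ∃ (q' : DegHom Q M.gm t) (r' : DegHom Q N.gm u),
      (∀ {n m l : ℤ} (h : n + s = m) (h' : n + t = l) (h'' : l + -1 = m) (x : Q.M n),
        M.dd.app h'' (q'.app h' x) = q.app h x) ∧
      (∀ {n m l : ℤ} (h : n + t = m) (h' : n + u = l) (h'' : l + -1 = m) (x : Q.M n),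
        N.dd.app h'' (r'.app h' x) = g.g.app m (q'.app h x) - r.app h x) := by
  rw [quasiIso_iff] at hg
  let f : DegHom Q (M.gm.prod (gsh 1 N.gm)) s :=
    { app := fun {n m} h => AddMonoidHom.prod (q.app h) (r.app (by omega))
      app_smul := fun h h₁ h₂ h₃ x a => Prod.ext (q.app_smul h h₁ h₂ h₃ x a)
        (r.app_smul h (by omega) (by omega) (by omega) x a) }
  obtain ⟨F, hF⟩ := hQ.exists_degHom_lift (show t + -1 = s by omega) (coneD g) f (by
    intro n m l hm hl x
    obtain rfl : m + 1 = l := by omega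
    obtain ⟨v, hv⟩ := hg.2 (show m + -1 = m - 1 by omega) hl (q.app hm x)
      (r.app (by omega) x) (hq hm _ x) (hr hm (by omega) hl x)
    obtain ⟨y, hy, w, hw⟩ := hg.1 hl (show m + 1 + 1 + -1 = m + 1 by omega)
      (r.app (show n + t = m + 1 by omega) x - g.g.app _ v) (by
        rw [map_sub, hr hm, ← DGHom.comm_dd, hv, sub_self])
    refine ⟨(v + y, w), Prod.ext ?_ ?_⟩
    · change M.dd.app _ (v + y) = q.app hm x
      rw [map_add, hv, hy, add_zero]
    · change g.g.app _ (v + y) - N.dd.app _ w = r.app _ x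
      rw [hw, map_add]
      abel)
  refine ⟨⟨fun {n m} h => (AddMonoidHom.fst _ _).comp (F.app h), ?_⟩,
    ⟨fun {n m} h => (N.gm.tr (show n + t + 1 = m by omega)).comp
      ((AddMonoidHom.snd _ _).comp (F.app rfl)), ?_⟩, ?_, ?_⟩
  · intro n k l n' l' h h₁ h₂ h₃ x a
    exact congrArg Prod.fst (F.app_smul h h₁ h₂ h₃ x a)
  · intro n k l n' l' h h₁ h₂ h₃ x a
    obtain rfl : n + t + 1 = n' := by omega
    obtain rfl : l + t + 1 = l' := by omega
    exact congrArg Prod.snd (F.app_smul h rfl rfl (by omega) x a)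
  · intro n m l h h' h'' x
    exact congrArg Prod.fst (hF h h' h'' x)
  · intro n m l h h' h'' x
    subst h
    obtain rfl : n + t + 1 = l := by omega
    have := congrArg Prod.snd (hF (m := n + t - 1) (by omega) rfl (by omega) x)
    change N.gm.tr _ (g.g.app _ (F.app _ x).1) - N.dd.app _ (F.app _ x).2 = r.app _ x at this
    have h3 : r.app (show n + t = n + t - 1 + 1 by omega) x =
        N.gm.tr (by omega) (r.app (rfl : n + t = n + t) x) := by
      have := r.app_tr rfl (show n + t = n + t - 1 + 1 by omega) rfl (by omega) x
      simpa using this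
    have h4 : N.dd.app (show n + t + 1 + -1 = n + t - 1 + 1 by omega) (F.app rfl x).2 =
        N.gm.tr (by omega) (N.dd.app h'' (F.app rfl x).2) := by
      have := N.dd.app_tr rfl (show n + t = n + t - 1 + 1 by omega) h'' (by omega)
        (F.app rfl x).2
      simpa using this
    rw [h3] at this
    erw [h4] at this
    rw [← map_sub] at this
    have inj : Function.Injective (N.gm.tr (show n + t = n + t - 1 + 1 by omega)) := by
      generalize_proofs pf
      revert pf
      generalize n + t - 1 + 1 = z
      rintro rfl
      exact Function.injective_id
    have h5 := inj this
    rw [← h5]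
    change N.dd.app h'' (F.app rfl x).2 = _
    change _ = g.g.app _ (F.app _ x).1 - (g.g.app _ (F.app _ x).1 - N.dd.app _ (F.app _ x).2)
    abel

end DGTheory

section Homotopy

variable {P : C}

@[simp] theorem GHom.toDeg_app {M N : GradedModule P} (f : GHom M N) {n : ℤ} (h : n + 0 = n)
    (x : M.M n) : f.toDeg.app h x = f.app n x := rfl

/-- The homotopy relation on morphisms of DG modules. -/
def DGHomotopic {W M : DGMod P} (φ ψ : W ⟶ M) : Prop :=
  ∃ H : DegHom W.gm M.gm 1, ∀ {n m l : ℤ} (h : n + 1 = m) (h' : m + -1 = n) (h'' : n + -1 = l)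
    (h₃' : l + 1 = n) (x : W.gm.M n),
    φ.g.app n x - ψ.g.app n x = M.dd.app h' (H.app h x) + H.app h₃' (W.dd.app h'' x)

theorem dgHomotopic_equivalence (W M : DGMod P) :
    Equivalence (DGHomotopic (W := W) (M := M)) where
  refl φ := ⟨0, fun h h' h'' h₃' x => by simp⟩
  symm := by
    rintro φ ψ ⟨H, hH⟩
    refine ⟨-H, fun h h' h'' h₃' x => ?_⟩
    rw [← neg_sub, hH h h' h'' h₃']
    simp only [DegHom.neg_app, map_neg]
    abel
  trans := by
    rintro φ ψ χ ⟨H, hH⟩ ⟨H', hH'⟩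
    refine ⟨H + H', fun h h' h'' h₃' x => ?_⟩
    rw [← sub_add_sub_cancel _ (ψ.g.app _ x), hH h h' h'' h₃', hH' h h' h'' h₃']
    simp only [DegHom.add_app, map_add]
    abel

theorem DGHomotopic.comp {W M N : DGMod P} {φ ψ : W ⟶ M} (g : M ⟶ N) (h : DGHomotopic φ ψ) :
    DGHomotopic (φ ≫ g) (ψ ≫ g) := by
  obtain ⟨H, hH⟩ := h
  refine ⟨H.post g.g, fun h h' h'' h₃' x => ?_⟩
  simp only [dgMod_comp_app, DegHom.post_app]
  rw [← map_sub, hH h h' h'' h₃', map_add, DGHom.comm_dd]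

/-- The graded module `M × M × M[1]` underlying the path object of a DG module. -/
def pathD (M : DGMod P) :
    DegHom ((M.gm.prod M.gm).prod (gsh 1 M.gm)) ((M.gm.prod M.gm).prod (gsh 1 M.gm)) (-1) where
  app {n m} h := AddMonoidHom.mk' (fun x => ((M.dd.app h x.1.1, M.dd.app h x.1.2),
      M.gm.tr (by omega) (x.1.1 - x.1.2) - M.dd.app (by omega) x.2)) (by
    intro x y
    refine Prod.ext (Prod.ext (map_add _ _ _) (map_add _ _ _)) ?_
    simp only [Prod.fst_add, Prod.snd_add, map_add, map_sub]
    abel)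
  app_smul {n k l n' l'} h h₁ h₂ h₃ x a := by
    obtain rfl : n' + 1 = n := by omega
    obtain rfl : l' + 1 = l := by omega
    refine Prod.ext (Prod.ext (M.dd.app_smul h h₁ h₂ h₃ x.1.1 a)
      (M.dd.app_smul h h₁ h₂ h₃ x.1.2 a)) ?_
    change ((M.gm.smul h x.1.1 a - M.gm.smul h x.1.2 a : M.gm.M (l' + 1)) -
        M.dd.app _ (M.gm.smul _ x.2 a) : M.gm.M (l' + 1)) =
      M.gm.smul _ ((x.1.1 - x.1.2 : M.gm.M (n' + 1)) - M.dd.app _ x.2) a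
    rw [M.dd.app_smul (n' := n' + 1) (h₁ := by omega) (h₃ := by omega)]
    refine Eq.symm ((map_sub (M.gm.smulAddHom _ a) _ _).trans ?_)
    exact congrArg₂ (fun t t' : M.gm.M (l' + 1) => t - t') (map_sub (M.gm.smulAddHom _ a) _ _) rfl

/-- The path object of a DG module. -/
@[reducible] def pathDG (M : DGMod P) : DGMod P where
  gm := (M.gm.prod M.gm).prod (gsh 1 M.gm)
  d h := (pathD M).app (by omega)
  d_sq {n m j} h h' x := by
    subst h h'
    refine Prod.ext (Prod.ext (M.dd_dd _ _ _) (M.dd_dd _ _ _)) ?_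
    change (M.dd.app _ x.1.1 - M.dd.app _ x.1.2 : M.gm.M (j + 1)) -
      M.dd.app _ ((x.1.1 - x.1.2 : M.gm.M (j + 1 + 1)) - M.dd.app _ x.2) = 0
    rw [map_sub, M.dd_dd, map_sub, sub_zero]
    exact sub_self _
  d_smul h hl hl' hm x a := (pathD M).app_smul hl _ _ hm x a

/-- The first projection from the path object. -/
def pathFst (M : DGMod P) : pathDG M ⟶ M where
  g := ⟨fun n => (AddMonoidHom.fst _ _).comp (AddMonoidHom.fst _ _), fun _ _ _ => rfl⟩
  comm _ _ := rfl

/-- The second projection from the path object. -/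
def pathSnd (M : DGMod P) : pathDG M ⟶ M where
  g := ⟨fun n => (AddMonoidHom.snd _ _).comp (AddMonoidHom.fst _ _), fun _ _ _ => rfl⟩
  comm _ _ := rfl

/-- The constant paths. -/
def pathConst (M : DGMod P) : M ⟶ pathDG M where
  g := ⟨fun n => AddMonoidHom.prod (AddMonoidHom.prod (AddMonoidHom.id _) (AddMonoidHom.id _)) 0,
    fun h _ a => Prod.ext rfl (M.gm.zero_smulₓ _ a).symm⟩
  comm h x := by
    subst h
    refine Prod.ext rfl ?_
    change 0 = (x - x) - M.dd.app _ 0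
    rw [map_zero, sub_self, sub_zero]

theorem quasiIso_pathConst (M : DGMod P) : quasiIso P (pathConst M) := by
  rw [quasiIso_iff]
  constructor
  · intro n m l h h' z hz
    obtain rfl : m + 1 = n := by omega
    obtain rfl : m + 1 + 1 = l := by omega
    obtain ⟨⟨a, b⟩, c⟩ := z
    have ha : M.dd.app h a = 0 := congrArg (fun z => z.1.1) hz
    have hb : M.dd.app h b = 0 := congrArg (fun z => z.1.2) hz
    have hc : (a - b) - M.dd.app (by omega) c = 0 := congrArg Prod.snd hz
    refine ⟨b, hb, ((-c, (0 : M.gm.M (m + 1 + 1))), (0 : M.gm.M (m + 1 + 1 + 1))), ?_⟩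
    refine Prod.ext (Prod.ext ?_ ?_) ?_
    · change M.dd.app _ (-c) = b - a
      rw [map_neg]
      rw [sub_eq_zero] at hc
      rw [← neg_sub a b, hc]
    · change M.dd.app _ 0 = b - b
      rw [map_zero, sub_self]
    · change (-c - 0) - M.dd.app _ 0 = 0 - c
      rw [map_zero]; abel
  · intro n m l h h' x w hx hw
    exact ⟨w.1.1, congrArg (fun z => z.1.1) hw⟩

theorem DGHomotopic.map_eq {W M : DGMod P} {φ ψ : W ⟶ M} (h : DGHomotopic φ ψ) :
    (quasiIso P).Q.map φ = (quasiIso P).Q.map ψ := by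
  obtain ⟨H, hH⟩ := h
  let Φ : W ⟶ pathDG M :=
    { g := ⟨fun n => AddMonoidHom.prod (AddMonoidHom.prod (φ.g.app n) (ψ.g.app n))
          (H.app (rfl : n + 1 = n + 1)),
        fun h x a => Prod.ext (Prod.ext (φ.g.app_smul h x a) (ψ.g.app_smul h x a))
          (H.app_smul h rfl rfl _ x a)⟩
      comm := by
        intro n m h x
        subst h
        refine Prod.ext (Prod.ext (φ.comm _ _) (ψ.comm _ _)) ?_
        change H.app _ (W.dd.app (show m + 1 + -1 = m by omega) x) = (φ.g.app _ x - ψ.g.app _ x) -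
          M.dd.app (show m + 1 + 1 + -1 = m + 1 by omega) (H.app rfl x)
        rw [hH rfl (show m + 1 + 1 + -1 = m + 1 by omega) (show m + 1 + -1 = m by omega) rfl]
        exact (add_sub_cancel_left _ _).symm }
  have hQ := Localization.inverts (quasiIso P).Q (quasiIso P) _ (quasiIso_pathConst M)
  have h1 : (quasiIso P).Q.map (pathFst M) = (quasiIso P).Q.map (pathSnd M) := by
    rw [← cancel_epi ((quasiIso P).Q.map (pathConst M)), ← Functor.map_comp, ← Functor.map_comp]
    rfl
  have h2 : φ = Φ ≫ pathFst M := rfl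
  have h3 : ψ = Φ ≫ pathSnd M := rfl
  rw [h2, h3, Functor.map_comp, Functor.map_comp, h1]

/-- The two-step DG module `K × L` with differential `(k, l) ↦ (0, ιk)`. -/
@[reducible] def twoStep {K L : GradedModule P} (ι : DegHom K L (-1)) : DGMod P where
  gm := K.prod L
  d h := AddMonoidHom.prod 0 ((ι.app (by omega)).comp (AddMonoidHom.fst _ _))
  d_sq h h' x := Prod.ext rfl (map_zero (ι.app _))
  d_smul h hl hl' hm x a := Prod.ext (K.zero_smulₓ hm a).symm
    (ι.app_smul hl (by omega) (by omega) hm x.1 a)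

section

variable {K L : GradedModule P} (ι : DegHom K L (-1))

theorem twoStep_dd {n m : ℤ} (h : n + -1 = m) (k : K.M n) (l : L.M n) :
    (twoStep ι).dd.app h (k, l) = (0, ι.app h k) := rfl

/-- The morphism out of a two-step DG module with given components. -/
def twoStepDesc {M : DGMod P} (x : GHom L M.gm) (y : GHom K M.gm)
    (hx : ∀ {n m : ℤ} (h : n + -1 = m) (l : L.M n), M.dd.app h (x.app n l) = 0)
    (hy : ∀ {n m : ℤ} (h : n + -1 = m) (k : K.M n),
      M.dd.app h (y.app n k) = x.app m (ι.app h k)) : twoStep ι ⟶ M where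
  g := ⟨fun n => AddMonoidHom.mk' (fun z => y.app n z.1 + x.app n z.2) (by
      intro z w
      simp only [Prod.fst_add, Prod.snd_add, map_add]
      abel), by
    intro n k l h z a
    change y.app l (K.smul h z.1 a) + x.app l (L.smul h z.2 a) = M.gm.smul h (_ + _) a
    rw [y.app_smul, x.app_smul, M.gm.add_smulₓ]⟩
  comm {n m} h z := by
    change y.app m 0 + x.app m (ι.app _ z.1) = M.dd.app (by omega) (y.app n z.1 + x.app n z.2)
    rw [map_add, hx, hy, map_zero, zero_add, add_zero]

@[simp] theorem twoStepDesc_app {M : DGMod P} (x : GHom L M.gm) (y : GHom K M.gm) (hx) (hy)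
    {n : ℤ} (k : K.M n) (l : L.M n) :
    (twoStepDesc ι (M := M) x y hx hy).g.app n (k, l) = y.app n k + x.app n l := rfl

/-- The inclusion of the first factor as a graded module. -/
def prodInl (K L : GradedModule P) : GHom K (K.prod L) where
  app n := AddMonoidHom.inl _ _
  app_smul h k a := Prod.ext rfl (L.zero_smulₓ h a).symm

/-- The inclusion of the second factor as a graded module. -/
def prodInr (K L : GradedModule P) : GHom L (K.prod L) where
  app n := AddMonoidHom.inr _ _
  app_smul h k a := Prod.ext (K.zero_smulₓ h a).symm rfl

theorem prod_decomp {K L M : GradedModule P} (f : GHom (K.prod L) M) {n : ℤ} (z : (K.prod L).M n) :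
    f.app n z = (f.comp (prodInl K L)).app n z.1 + (f.comp (prodInr K L)).app n z.2 := by
  change f.app n z = f.app n (z.1, 0) + f.app n (0, z.2)
  rw [← map_add]
  congr 1
  exact Prod.ext (add_zero _).symm (zero_add _).symm

theorem twoStep_inr_cycle {M : DGMod P} (φ : twoStep ι ⟶ M) {n m : ℤ} (h : n + -1 = m)
    (l : L.M n) : M.dd.app h ((GHom.comp φ.g (prodInr K L)).app n l) = 0 := by
  refine (φ.comm_dd h (0, l)).symm.trans ?_
  rw [twoStep_dd, map_zero]
  exact map_zero _

theorem twoStep_inl_dd {M : DGMod P} (φ : twoStep ι ⟶ M) {n m : ℤ} (h : n + -1 = m)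
    (k : K.M n) : M.dd.app h ((GHom.comp φ.g (prodInl K L)).app n k) =
      (GHom.comp φ.g (prodInr K L)).app m (ι.app h k) :=
  (φ.comm_dd h (k, 0)).symm

/-- The combination of two degree `s` homomorphisms on a product. -/
def DegHom.coprod {K L M : GradedModule P} {s : ℤ} (f : DegHom K M s) (g : DegHom L M s) :
    DegHom (K.prod L) M s where
  app h := AddMonoidHom.mk' (fun z => f.app h z.1 + g.app h z.2) (by
      intro z w
      simp only [Prod.fst_add, Prod.snd_add, map_add]
      abel)
  app_smul {n k l n' l'} h h₁ h₂ h₃ z a := by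
    change f.app h₂ (K.smul h z.1 a) + g.app h₂ (L.smul h z.2 a) = M.smul h₃ (_ + _) a
    rw [f.app_smul h h₁ h₂ h₃, g.app_smul h h₁ h₂ h₃, M.add_smulₓ]

theorem DegHom.coprod_app {K L M : GradedModule P} {s : ℤ} (f : DegHom K M s) (g : DegHom L M s)
    {n m : ℤ} (h : n + s = m) (z : (K.prod L).M n) :
    (f.coprod g).app h z = f.app h z.1 + g.app h z.2 := rfl

theorem twoStep_homotopy_lift (hK : IsProjective K) (hL : IsProjective L) {M N : DGMod P}
    (g : M ⟶ N) (hg : quasiIso P g) (ψ : twoStep ι ⟶ N) :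
    ∃ φ : twoStep ι ⟶ M, DGHomotopic (φ ≫ g) ψ := by
  set x := GHom.comp ψ.g (prodInr K L) with hx
  set y := GHom.comp ψ.g (prodInl K L) with hy
  obtain ⟨x', h, h1, h2⟩ := exists_lift_of_quasiIso g hg hL (show (-1 : ℤ) + 1 = 0 by omega)
    (show (0 : ℤ) + 1 = 1 by omega) 0 x.toDeg (by intros; simp) (by
      intro n m l h h' h'' z
      obtain rfl : n = l := by omega
      simpa using twoStep_inr_cycle ι ψ h'' z)
  obtain ⟨y', k, h3, h4⟩ := exists_lift_of_quasiIso g hg hK (show (-1 : ℤ) + 1 = 0 by omega)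
    (show (0 : ℤ) + 1 = 1 by omega)
    ⟨fun {n m} e => (x'.app (add_zero m)).comp (ι.app e), fun e e₁ e₂ e₃ z a => by
      simp only [AddMonoidHom.comp_apply]
      rw [ι.app_smul e e₁ e₂ e₃, x'.app_smul e₃ _ _ e₃]⟩
    (y.toDeg + ⟨fun {n m} e => (h.app (show (n - 1) + 1 = m by omega)).comp (ι.app rfl),
      fun e e₁ e₂ e₃ z a => by
      simp only [AddMonoidHom.comp_apply]
      rw [ι.app_smul e rfl rfl (by omega), h.app_smul (by omega) _ _ e₃]⟩)
    (by
      intro n m l e e' z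
      simp only [AddMonoidHom.comp_apply]
      rw [h1 e' (add_zero m) e']
      rfl)
    (by
      intro n m l e e' e'' z
      obtain rfl : n = l := by omega
      obtain rfl : n - 1 = m := by omega
      simp only [DegHom.add_app, map_add, AddMonoidHom.comp_apply]
      rw [h2 (add_zero _) (show n - 1 + 1 = n by omega) e'', GHom.toDeg_app, GHom.toDeg_app,
        twoStep_inl_dd ι ψ e'']
      exact add_sub_cancel _ _)
  have hx' : ∀ {n m : ℤ} (e : n + -1 = m) (z : L.M n),
      M.dd.app e (x'.toGHom.app n z) = 0 := fun e z => h1 e (add_zero _) e z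
  have hy' : ∀ {n m : ℤ} (e : n + -1 = m) (z : K.M n),
      M.dd.app e (y'.toGHom.app n z) = x'.toGHom.app m (ι.app e z) :=
    fun e z => h3 e (add_zero _) e z
  refine ⟨twoStepDesc ι x'.toGHom y'.toGHom hx' hy', k.coprod h, ?_⟩
  · intro n m l e e' e'' e₃' z
    obtain ⟨κ, z⟩ := z
    obtain rfl : n - 1 = l := by omega
    rw [prod_decomp ψ.g, twoStep_dd, dgMod_comp_app, twoStepDesc_app, DegHom.coprod_app,
      DegHom.coprod_app, map_add, map_add, h4 (add_zero n) e e', h2 (add_zero n) e e', map_zero,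
      DegHom.add_app, GHom.toDeg_app, GHom.toDeg_app]
    change g.g.app n (y'.app _ κ) + g.g.app n (x'.app _ z) - (y.app n κ + x.app n z) =
      g.g.app n (y'.app _ κ) - (y.app n κ + h.app _ (ι.app _ κ)) +
        (g.g.app n (x'.app _ z) - x.app n z) + (0 + h.app _ (ι.app _ κ))
    abel

theorem twoStep_homotopic_of_comp (hK : IsProjective K) (hL : IsProjective L) {M N : DGMod P}
    (g : M ⟶ N) (hg : quasiIso P g) (φ ψ : twoStep ι ⟶ M) (H : DGHomotopic (φ ≫ g) (ψ ≫ g)) :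
    DGHomotopic φ ψ := by
  obtain ⟨H, hH⟩ := H
  set x := GHom.comp φ.g (prodInr K L) - GHom.comp ψ.g (prodInr K L) with hx
  set y := GHom.comp φ.g (prodInl K L) - GHom.comp ψ.g (prodInl K L) with hy
  have sub_app : ∀ {A B : GradedModule P} (a b : GHom A B) {n : ℤ} (z : A.M n),
      (a - b).app n z = a.app n z - b.app n z := by
    intro A B a b n z
    rw [sub_eq_add_neg, GHom.add_app, GHom.neg_app, sub_eq_add_neg]
  set h := H.pre (prodInr K L) with hh
  set k := H.pre (prodInl K L) with hk
  have hx1 : ∀ {n m : ℤ} (e : n + 1 = m) (e' : m + -1 = n) (z : L.M n),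
      N.dd.app e' (h.app e z) = g.g.app n (x.app n z) := by
    intro n m e e' z
    have := hH e e' (show n + -1 = n - 1 by omega) (by omega) (0, z)
    rw [twoStep_dd, map_zero] at this
    rw [sub_app, map_sub]
    refine Eq.symm (this.trans ?_)
    have h0 : H.app (show n - 1 + 1 = n by omega) ((0, 0) : (K.prod L).M (n - 1)) = 0 :=
      map_zero _
    erw [h0]
    exact add_zero _
  have hy1 : ∀ {n m l : ℤ} (e : n + 1 = m) (e' : m + -1 = n) (e'' : n + -1 = l) (e₃' : l + 1 = n)
      (z : K.M n), g.g.app n (y.app n z) = N.dd.app e' (k.app e z) + h.app e₃' (ι.app e'' z) := by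
    intro n m l e e' e'' e₃' z
    have := hH e e' e'' e₃' (z, 0)
    rw [sub_app, map_sub]
    exact this
  have hxc : ∀ {n m : ℤ} (e : n + -1 = m) (z : L.M n), M.dd.app e (x.app n z) = 0 := by
    intro n m e z
    rw [sub_app, map_sub, twoStep_inr_cycle ι φ, twoStep_inr_cycle ι ψ, sub_zero]
  have hyc : ∀ {n m : ℤ} (e : n + -1 = m) (z : K.M n),
      M.dd.app e (y.app n z) = x.app m (ι.app e z) := by
    intro n m e z
    rw [sub_app, map_sub, twoStep_inl_dd ι φ, twoStep_inl_dd ι ψ, sub_app]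
  obtain ⟨h', l, h1, h2⟩ := exists_lift_of_quasiIso g hg hL (show (0 : ℤ) + 1 = 1 by omega)
    (show (1 : ℤ) + 1 = 2 by omega) x.toDeg h
    (by
      intro n m l e e' z
      obtain rfl : n = m := by omega
      exact hxc e' z)
    (by
      intro n m l e e' e'' z
      obtain rfl : n = m := by omega
      exact hx1 e' e'' z)
  obtain ⟨k', _, h3, -⟩ := exists_lift_of_quasiIso g hg hK (show (0 : ℤ) + 1 = 1 by omega)
    (show (1 : ℤ) + 1 = 2 by omega)
    (y.toDeg - ⟨fun {n m} e => (h'.app (show (n - 1) + 1 = m by omega)).comp (ι.app rfl),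
      fun e e₁ e₂ e₃ z a => by
      simp only [AddMonoidHom.comp_apply]
      rw [ι.app_smul e rfl rfl (by omega), h'.app_smul (by omega) _ _ e₃]⟩)
    (k - ⟨fun {n m} e => (l.app (show (n - 1) + 2 = m by omega)).comp (ι.app rfl),
      fun e e₁ e₂ e₃ z a => by
      simp only [AddMonoidHom.comp_apply]
      rw [ι.app_smul e rfl rfl (by omega), l.app_smul (by omega) _ _ e₃]⟩)
    (by
      intro n m l e e' z
      obtain rfl : n = m := by omega
      obtain rfl : n - 1 = l := by omega
      rw [DegHom.sub_app, map_sub, GHom.toDeg_app, hyc]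
      simp only [AddMonoidHom.comp_apply]
      rw [h1 (add_zero _) (show n - 1 + 1 = n by omega) e', GHom.toDeg_app, sub_self])
    (by
      intro n m j e e' e'' z
      obtain rfl : n = m := by omega
      rw [DegHom.sub_app, map_sub, DegHom.sub_app, map_sub, GHom.toDeg_app,
        hy1 e' e'' (show n + -1 = n - 1 by omega) (by omega)]
      simp only [AddMonoidHom.comp_apply]
      rw [h2 (show n - 1 + 1 = n by omega) (by omega) e'']
      abel)
  refine ⟨k'.coprod h', ?_⟩
  intro n m l e e' e'' e₃' z
  obtain ⟨κ, z⟩ := z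
  obtain rfl : n - 1 = l := by omega
  have a1 := h1 (add_zero n) e e' z
  have a2 := h3 (add_zero n) e e' κ
  rw [prod_decomp φ.g, prod_decomp ψ.g, twoStep_dd, DegHom.coprod_app, DegHom.coprod_app, map_add,
    a1, a2, map_zero, DegHom.sub_app, GHom.toDeg_app, GHom.toDeg_app, sub_app, sub_app]
  change _ = _ - _ - h'.app _ (ι.app _ κ) + _ + (0 + h'.app _ (ι.app _ κ))
  abel

/-- Morphisms in the derived category out of a two-step DG module with projective terms are
homotopy classes of morphisms of DG modules. -/
theorem twoStep_localization_hom (hK : IsProjective K) (hL : IsProjective L) (M : DGMod P) :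
    (∀ φ : (quasiIso P).Q.obj (twoStep ι) ⟶ (quasiIso P).Q.obj M,
      ∃ a : twoStep ι ⟶ M, (quasiIso P).Q.map a = φ) ∧
    ∀ a b : twoStep ι ⟶ M, (quasiIso P).Q.map a = (quasiIso P).Q.map b ↔ DGHomotopic a b := by
  obtain ⟨h1, h2⟩ := localization_hom_of_quotHom_bijective (quasiIso P) (twoStep ι)
    (fun M => DGHomotopic) (fun g a b h => h.comp g)
    (by
      intro M N g hg
      constructor
      · intro a b hab
        induction a using Quot.ind with | _ a =>
        induction b using Quot.ind with | _ b =>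
        have : DGHomotopic (a ≫ g) (b ≫ g) := (dgHomotopic_equivalence _ _).quot_mk_eq_iff _ _ |>.mp
          hab
        exact Quot.sound (twoStep_homotopic_of_comp ι hK hL g hg a b this)
      · intro b
        induction b using Quot.ind with | _ b =>
        obtain ⟨a, ha⟩ := twoStep_homotopy_lift ι hK hL g hg b
        exact ⟨Quot.mk _ a, Quot.sound ha⟩)
    (fun a b h => h.map_eq) M
  refine ⟨h1, fun a b => ⟨fun h => ?_, fun h => h.map_eq⟩⟩
  exact (dgHomotopic_equivalence _ _).quot_mk_eq_iff _ _ |>.mp (h2 a b h)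

end

end Homotopy

section HomsFromGenerator

variable (P : C)

/-- The isomorphism `Hom(Σⁿ P, X) ≃ Hom(Σⁿ⁺¹ P, Σ X)` as a homomorphism of degree one. -/
def piShift (X : C) : DegHom (piMod P X) (piMod P (X⟦(1 : ℤ)⟧)) 1 where
  app {n m} h := AddMonoidHom.mk'
    (fun x => (shiftFunctorAdd' C n 1 m h).hom.app P ≫ x⟦(1 : ℤ)⟧')
    (fun x y => by simp [Functor.map_add, Preadditive.comp_add])
  app_smul {n k l n' l'} h h₁ h₂ h₃ x a := by
    change (shiftFunctorAdd' C l 1 l' h₂).hom.app P ≫ (gsmulHom P h x a)⟦(1 : ℤ)⟧' =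
      gsmulHom P h₃ ((shiftFunctorAdd' C n 1 n' h₁).hom.app P ≫ x⟦(1 : ℤ)⟧') a
    simp only [gsmulHom, Functor.map_comp]
    have nat := (shiftFunctorAdd' C n 1 n' h₁).hom.naturality a
    dsimp at nat
    rw [reassoc_of% nat, shiftFunctorAdd'_assoc_hom_app_assoc k n 1 l n' l' (by omega) (by omega)
      (by omega) P]

theorem piShift_app {X : C} {n m : ℤ} (h : n + 1 = m) (x : P⟦n⟧ ⟶ X) :
    (piShift P X).app h x = (shiftFunctorAdd' C n 1 m h).hom.app P ≫ x⟦(1 : ℤ)⟧' := rfl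

theorem piShift_bijective (X : C) {n m : ℤ} (h : n + 1 = m) :
    Function.Bijective ((piShift P X).app h) := by
  constructor
  · intro x y hxy
    rw [piShift_app, piShift_app, cancel_epi] at hxy
    exact (shiftFunctor C (1 : ℤ)).map_injective hxy
  · intro y
    obtain ⟨x, hx⟩ := (shiftFunctor C (1 : ℤ)).map_surjective
      ((shiftFunctorAdd' C n 1 m h).inv.app P ≫ y)
    refine ⟨x, ?_⟩
    rw [piShift_app, hx, Iso.hom_inv_id_app_assoc]

/-- The homomorphism of degree one `π_* X → π_* Y` induced by a morphism `ΣX ⟶ Y`. -/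
def piDeg {X Y : C} (g : X⟦(1 : ℤ)⟧ ⟶ Y) : DegHom (piMod P X) (piMod P Y) 1 :=
  (piShift P X).post (piGHom P g)

variable {P}

theorem piGHom_app {X Y : C} (f : X ⟶ Y) {n : ℤ} (x : P⟦n⟧ ⟶ X) :
    (piGHom P f).app n x = x ≫ f := rfl

theorem piDeg_app {X Y : C} (g : X⟦(1 : ℤ)⟧ ⟶ Y) {n m : ℤ} (h : n + 1 = m) (x : P⟦n⟧ ⟶ X) :
    (piDeg P g).app h x = (piShift P X).app h x ≫ g := rfl

theorem piShift_comp {X Y : C} (f : X ⟶ Y) {n m : ℤ} (h : n + 1 = m) (x : P⟦n⟧ ⟶ X) :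
    (piShift P Y).app h (x ≫ f) = (piShift P X).app h x ≫ f⟦(1 : ℤ)⟧' := by
  rw [piShift_app, piShift_app, Functor.map_comp, Category.assoc]

@[simp] theorem GHom.comp_app {M N L : GradedModule P} (g : GHom N L) (f : GHom M N) {n : ℤ}
    (x : M.M n) : (g.comp f).app n x = g.app n (f.app n x) := rfl

@[simp] theorem GHom.id_app (M : GradedModule P) {n : ℤ} (x : M.M n) :
    (GHom.id M).app n x = x := rfl

variable (P)

/-- An object out of which morphisms are the same as morphisms of homotopy modules. -/
def Good (X : C) : Prop :=
  ∀ Y : C, Function.Bijective (fun f : X ⟶ Y => piGHom P f)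

/-- An object out of which morphisms are detected on homotopy modules. -/
def PiFaithful (X : C) : Prop :=
  ∀ (Y : C) (a : X ⟶ Y), (∀ (n : ℤ) (x : P⟦n⟧ ⟶ X), x ≫ a = 0) → a = 0

variable {P}

theorem Good.piFaithful {X : C} (hX : Good P X) : PiFaithful P X := by
  intro Y a ha
  apply (hX Y).1
  ext n x
  exact (ha n x).trans comp_zero.symm

theorem PiFaithful.ext {X Y : C} (hX : PiFaithful P X) {a b : X ⟶ Y}
    (h : ∀ (n : ℤ) (x : P⟦n⟧ ⟶ X), x ≫ a = x ≫ b) : a = b := by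
  rw [← sub_eq_zero]
  apply hX
  intro n x
  rw [Preadditive.comp_sub, h, sub_self]

theorem Good.exists_hom {X Y : C} (hX : Good P X) (F : GHom (piMod P X) (piMod P Y)) :
    ∃ f : X ⟶ Y, ∀ (n : ℤ) (x : P⟦n⟧ ⟶ X), x ≫ f = F.app n x := by
  obtain ⟨f, hf⟩ := (hX Y).2 F
  exact ⟨f, fun n x => GHom.congr_app hf x⟩

theorem good_of_exists {X : C} (hf : PiFaithful P X)
    (h : ∀ (Y : C) (F : GHom (piMod P X) (piMod P Y)),
      ∃ f : X ⟶ Y, ∀ (n : ℤ) (x : P⟦n⟧ ⟶ X), x ≫ f = F.app n x) : Good P X := by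
  intro Y
  constructor
  · intro a b hab
    exact hf.ext fun n x => GHom.congr_app hab x
  · intro F
    obtain ⟨f, hf⟩ := h Y F
    exact ⟨f, GHom.ext hf⟩

theorem Good.of_retract {X Y : C} (hX : Good P X) (i : Y ⟶ X) (p : X ⟶ Y) (h : i ≫ p = 𝟙 Y) :
    Good P Y := by
  apply good_of_exists
  · intro Z a ha
    have : p ≫ a = 0 := hX.piFaithful _ _ fun n x => by rw [← Category.assoc]; exact ha _ _
    rw [← Category.id_comp a, ← h, Category.assoc, this, comp_zero]
  · intro Z F
    obtain ⟨f, hf⟩ := hX.exists_hom (F.comp (piGHom P p))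
    refine ⟨i ≫ f, fun n x => ?_⟩
    rw [← Category.assoc, hf]
    change F.app n ((x ≫ i) ≫ p) = _
    rw [Category.assoc, h, Category.comp_id]

theorem PiFaithful.shift {X : C} (hX : PiFaithful P X) : PiFaithful P (X⟦(1 : ℤ)⟧) := by
  intro Y a ha
  let e := (shiftFunctorCompIsoId C (-1 : ℤ) 1 (by omega)).app Y
  obtain ⟨f, hf⟩ := (shiftFunctor C (1 : ℤ)).map_surjective (a ≫ e.inv)
  have : f = 0 := by
    apply hX
    intro n x
    apply (piShift_bijective P _ (rfl : n + 1 = n + 1)).1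
    rw [map_zero, piShift_comp, hf, ← Category.assoc, ha, zero_comp]
  rw [this, Functor.map_zero] at hf
  rw [← cancel_mono e.inv, ← hf, zero_comp]

theorem Good.exists_deg_hom {X Y : C} (hX : Good P X) (F : DegHom (piMod P X) (piMod P Y) 1) :
    ∃ g : X⟦(1 : ℤ)⟧ ⟶ Y, piDeg P g = F := by
  let e := (shiftFunctorCompIsoId C (-1 : ℤ) 1 (by omega)).app Y
  let F' := F.post (piGHom P e.inv)
  have hb := fun n : ℤ => piShift_bijective P (Y⟦(-1 : ℤ)⟧) (rfl : n + 1 = n + 1)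
  let θ := fun n : ℤ => Equiv.ofBijective _ (hb n)
  have hθ : ∀ {n : ℤ} y, (piShift P (Y⟦(-1 : ℤ)⟧)).app (rfl : n + 1 = n + 1) ((θ n).symm y) = y :=
    fun y => (θ _).apply_symm_apply y
  let G : GHom (piMod P X) (piMod P (Y⟦(-1 : ℤ)⟧)) :=
    { app := fun n => AddMonoidHom.mk' (fun x => (θ n).symm (F'.app rfl x)) (by
        intro x y
        apply (hb n).1
        rw [hθ, map_add, map_add, hθ, hθ])
      app_smul := by
        intro n k l h x a
        apply (hb l).1
        refine (hθ _).trans ?_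
        rw [(piShift P (Y⟦(-1 : ℤ)⟧)).app_smul h rfl rfl (by omega),
          F'.app_smul h rfl rfl (by omega)]
        exact congrArg (fun z => (piMod P _).smul _ z a) (hθ _).symm }
  obtain ⟨f, hf⟩ := hX.exists_hom G
  refine ⟨f⟦(1 : ℤ)⟧' ≫ e.hom, ?_⟩
  ext n m h x
  subst h
  rw [piDeg_app, ← Category.assoc, ← piShift_comp, hf]
  change (piShift P (Y⟦(-1 : ℤ)⟧)).app _ ((θ n).symm (F'.app rfl x)) ≫ _ = _
  rw [hθ]
  change (F.app _ x ≫ e.inv) ≫ e.hom = _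
  simp

theorem comp_mor₃_eq_zero {T : Triangle C} (hT : T ∈ distTriang C)
    (hinj : ∀ (n : ℤ) (x : P⟦n⟧ ⟶ T.obj₁), x ≫ T.mor₁ = 0 → x = 0) {n : ℤ} (x : P⟦n⟧ ⟶ T.obj₃) :
    x ≫ T.mor₃ = 0 := by
  obtain ⟨y, hy⟩ := (piShift_bijective P T.obj₁ (show n - 1 + 1 = n by omega)).2 (x ≫ T.mor₃)
  have : y = 0 := by
    apply hinj
    apply (piShift_bijective P T.obj₂ (show n - 1 + 1 = n by omega)).1
    rw [map_zero, piShift_comp, hy, Category.assoc, comp_distTriang_mor_zero₃₁ _ hT, comp_zero]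
  rw [← hy, this, map_zero]

end HomsFromGenerator

section Presentations

variable (P : C) (N : ℕ) [NeZero N]

/-- A decomposition of (the homotopy module of) an object according to the residue classes of
degrees modulo `N`. -/
structure Splitting (X : C) where
  p : ZMod N → (X ⟶ X)
  sum_eq : ∑ i, p i = 𝟙 X
  comp_eq_zero : ∀ (i : ZMod N) (n : ℤ), (n : ZMod N) ≠ i → ∀ x : P⟦n⟧ ⟶ X, x ≫ p i = 0

variable {P N}

namespace Splitting

variable {X Y : C} (p : Splitting P N X) (q : Splitting P N Y)

theorem comp_self (n : ℤ) (x : P⟦n⟧ ⟶ X) : x ≫ p.p n = x := by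
  have h : x ≫ ∑ i, p.p i = x := by rw [p.sum_eq, Category.comp_id]
  rw [Preadditive.comp_sum, Finset.sum_eq_single (n : ZMod N)
    (fun i _ hi => p.comp_eq_zero i n hi.symm x) (fun h => absurd (Finset.mem_univ _) h)] at h
  exact h

/-- The average of a morphism over the residue classes of degrees. -/
def avg (f : X ⟶ Y) : X ⟶ Y := ∑ i, p.p i ≫ f ≫ q.p i

theorem comp_avg (f : X ⟶ Y) {n : ℤ} (x : P⟦n⟧ ⟶ X) : x ≫ p.avg q f = x ≫ f := by
  rw [avg, Preadditive.comp_sum, Finset.sum_eq_single (n : ZMod N)]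
  · rw [← Category.assoc, p.comp_self, ← Category.assoc, q.comp_self]
  · intro i _ hi
    rw [← Category.assoc, p.comp_eq_zero i n hi.symm, zero_comp]
  · exact fun h => absurd (Finset.mem_univ _) h

theorem avg_eq (hX : PiFaithful P X) (f : X ⟶ Y) : p.avg q f = f :=
  hX.ext fun _ x => p.comp_avg q f x

theorem avg_of_comm (hq : ∀ i, q.p i ≫ q.p i = q.p i) (f : X ⟶ Y)
    (h : ∀ i, p.p i ≫ f = f ≫ q.p i) : p.avg q f = f := by
  have : ∀ i, p.p i ≫ f ≫ q.p i = f ≫ q.p i := fun i => by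
    rw [← Category.assoc, h, Category.assoc, hq]
  rw [avg, Finset.sum_congr rfl fun i _ => this i, ← Preadditive.comp_sum, q.sum_eq,
    Category.comp_id]

theorem p_comp_avg (hp : ∀ i j, p.p i ≫ p.p j = if i = j then p.p i else 0)
    (hq : ∀ i j, q.p i ≫ q.p j = if i = j then q.p i else 0) (f : X ⟶ Y) (i : ZMod N) :
    p.p i ≫ p.avg q f = p.avg q f ≫ q.p i := by
  simp only [avg, Preadditive.comp_sum, Preadditive.sum_comp, Category.assoc, hq]
  simp only [← Category.assoc, hp]
  rw [Finset.sum_eq_single i, Finset.sum_eq_single i]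
  · simp
  · intro j _ hj
    simp [hj]
  · simp
  · intro j _ hj
    simp [hj.symm]
  · simp

end Splitting

variable (P N)

/-- A distinguished triangle whose first two terms have projective homotopy modules forming a
length one resolution of the homotopy module of the third one, together with compatible
splittings. -/
structure Presentation where
  T : Triangle C
  dist : T ∈ distTriang C
  good₁ : Good P T.obj₁
  good₂ : Good P T.obj₂
  proj₁ : IsProjective (piMod P T.obj₁)
  proj₂ : IsProjective (piMod P T.obj₂)
  inj : ∀ (n : ℤ) (x : P⟦n⟧ ⟶ T.obj₁), x ≫ T.mor₁ = 0 → x = 0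
  split₁ : Splitting P N T.obj₁
  split₃ : Splitting P N T.obj₃
  comm : ∀ i, split₃.p i ≫ T.mor₃ = T.mor₃ ≫ (split₁.p i)⟦(1 : ℤ)⟧'
  orth : ∀ i j, split₃.p i ≫ split₃.p j = if i = j then split₃.p i else 0

variable {P N}

namespace Presentation

/-- A morphism of presentations, consisting of a morphism of resolutions and a morphism
representing a class in `Ext¹`. -/
@[ext] structure Hom (X Y : Presentation P N) where
  f₁ : X.T.obj₁ ⟶ Y.T.obj₁
  f₂ : X.T.obj₂ ⟶ Y.T.obj₂
  u : X.T.obj₁⟦(1 : ℤ)⟧ ⟶ Y.T.obj₂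
  comm : X.T.mor₁ ≫ f₂ = f₁ ≫ Y.T.mor₁

instance : Category (Presentation P N) where
  Hom := Hom
  id X := ⟨𝟙 _, 𝟙 _, 0, by simp⟩
  comp f g := ⟨f.f₁ ≫ g.f₁, f.f₂ ≫ g.f₂, f.f₁⟦(1 : ℤ)⟧' ≫ g.u + f.u ≫ g.f₂, by
    rw [← Category.assoc, f.comm, Category.assoc, g.comm, Category.assoc]⟩
  id_comp f := by apply Hom.ext <;> simp
  comp_id f := by apply Hom.ext <;> simp
  assoc f g h := by apply Hom.ext <;> simp [add_assoc]

@[simp] theorem id_f₁ (X : Presentation P N) : Hom.f₁ (𝟙 X) = 𝟙 _ := rfl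
@[simp] theorem id_f₂ (X : Presentation P N) : Hom.f₂ (𝟙 X) = 𝟙 _ := rfl
@[simp] theorem id_u (X : Presentation P N) : Hom.u (𝟙 X) = 0 := rfl

section

variable {X Y Z : Presentation P N}

@[simp] theorem comp_f₁ (f : X ⟶ Y) (g : Y ⟶ Z) : (f ≫ g).f₁ = f.f₁ ≫ g.f₁ := rfl
@[simp] theorem comp_f₂ (f : X ⟶ Y) (g : Y ⟶ Z) : (f ≫ g).f₂ = f.f₂ ≫ g.f₂ := rfl
@[simp] theorem comp_u (f : X ⟶ Y) (g : Y ⟶ Z) :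
    (f ≫ g).u = f.f₁⟦(1 : ℤ)⟧' ≫ g.u + f.u ≫ g.f₂ := rfl

theorem comp_mor₃ (X : Presentation P N) {n : ℤ} (x : P⟦n⟧ ⟶ X.T.obj₃) : x ≫ X.T.mor₃ = 0 :=
  comp_mor₃_eq_zero X.dist X.inj x

theorem exists_lift_mor₂ (X : Presentation P N) {n : ℤ} (x : P⟦n⟧ ⟶ X.T.obj₃) :
    ∃ y, x = y ≫ X.T.mor₂ :=
  Triangle.coyoneda_exact₃ _ X.dist x (X.comp_mor₃ x)

theorem zero₁₂ (X : Presentation P N) : X.T.mor₁ ≫ X.T.mor₂ = 0 :=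
  comp_distTriang_mor_zero₁₂ _ X.dist

theorem zero₁₂_assoc (X : Presentation P N) {A : C} (h : X.T.obj₃ ⟶ A) :
    X.T.mor₁ ≫ X.T.mor₂ ≫ h = 0 ≫ h := by
  rw [← Category.assoc, X.zero₁₂]

theorem zero₂₃ (X : Presentation P N) : X.T.mor₂ ≫ X.T.mor₃ = 0 :=
  comp_distTriang_mor_zero₂₃ _ X.dist

theorem zero₂₃_assoc (X : Presentation P N) {A : C} (h : X.T.obj₁⟦(1 : ℤ)⟧ ⟶ A) :
    X.T.mor₂ ≫ X.T.mor₃ ≫ h = 0 ≫ h := by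
  rw [← Category.assoc, X.zero₂₃]

theorem zero₃₁ (X : Presentation P N) : X.T.mor₃ ≫ X.T.mor₁⟦(1 : ℤ)⟧' = 0 :=
  comp_distTriang_mor_zero₃₁ _ X.dist

theorem zero₃₁_assoc (X : Presentation P N) {A : C} (h : X.T.obj₂⟦(1 : ℤ)⟧ ⟶ A) :
    X.T.mor₃ ≫ X.T.mor₁⟦(1 : ℤ)⟧' ≫ h = 0 ≫ h := by
  rw [← Category.assoc, X.zero₃₁]

theorem factor_of_piFaithful (Y : Presentation P N) {A : C} (hA : PiFaithful P A)
    (f : A ⟶ Y.T.obj₃) : ∃ g, f = g ≫ Y.T.mor₂ := by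
  apply Triangle.coyoneda_exact₃ _ Y.dist
  apply hA
  intro n x
  rw [← Category.assoc, Y.comp_mor₃]

theorem eq_zero_of_comm [Fact (1 < N)] (d : X.T.obj₃ ⟶ Y.T.obj₃) (h : X.T.mor₂ ≫ d = 0)
    (hd : ∀ i, X.split₃.p i ≫ d = d ≫ Y.split₃.p i) : d = 0 := by
  obtain ⟨a, rfl⟩ := Triangle.yoneda_exact₃ _ X.dist d h
  have hY : ∀ i, Y.split₃.p i ≫ Y.split₃.p i = Y.split₃.p i := fun i => by rw [Y.orth, if_pos rfl]
  rw [← X.split₃.avg_of_comm Y.split₃ hY _ hd, Splitting.avg]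
  apply Finset.sum_eq_zero
  intro i _
  rw [Category.assoc, reassoc_of% X.comm i]
  have : (X.split₁.p i)⟦(1 : ℤ)⟧' ≫ a ≫ Y.split₃.p i = 0 := by
    apply X.good₁.piFaithful.shift
    intro n x
    obtain ⟨y, rfl⟩ := (piShift_bijective P X.T.obj₁ (show n - 1 + 1 = n by omega)).2 x
    by_cases hi : (n : ZMod N) = i
    · rw [← Category.assoc, ← piShift_comp, X.split₁.comp_eq_zero i (n - 1), map_zero, zero_comp]
      rw [← hi]
      simp
    · rw [← Category.assoc, ← Category.assoc]
      exact Y.split₃.comp_eq_zero i n hi _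
  rw [this, comp_zero]

/-- The morphism on third objects induced by a morphism of resolutions, compatible with the
splittings. -/
theorem exists_third [Fact (1 < N)] (f : X ⟶ Y) :
    ∃ ψ : X.T.obj₃ ⟶ Y.T.obj₃, X.T.mor₂ ≫ ψ = f.f₂ ≫ Y.T.mor₂ ∧
      ψ ≫ Y.T.mor₃ = X.T.mor₃ ≫ f.f₁⟦(1 : ℤ)⟧' ∧
      ∀ i, X.split₃.p i ≫ ψ = ψ ≫ Y.split₃.p i := by
  obtain ⟨φ, h₁, h₂⟩ := complete_distinguished_triangle_morphism X.T Y.T X.dist Y.dist f.f₁ f.f₂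
    f.comm
  refine ⟨X.split₃.avg Y.split₃ φ, ?_, ?_, X.split₃.p_comp_avg _ X.orth Y.orth φ⟩
  · rw [← h₁]
    apply X.good₂.piFaithful.ext
    intro n x
    rw [← Category.assoc, Splitting.comp_avg, Category.assoc]
  · conv_rhs => rw [← X.split₁.avg_eq Y.split₁ X.good₁.piFaithful f.f₁]
    simp only [Splitting.avg, Functor.map_sum, Functor.map_comp, Preadditive.sum_comp,
      Preadditive.comp_sum, Category.assoc, Y.comm, ← reassoc_of% h₂, reassoc_of% X.comm]

/-- The chosen induced morphism on third objects. -/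
noncomputable def third [Fact (1 < N)] (f : X ⟶ Y) : X.T.obj₃ ⟶ Y.T.obj₃ :=
  (exists_third f).choose

section

variable [Fact (1 < N)]

theorem mor₂_third (f : X ⟶ Y) : X.T.mor₂ ≫ third f = f.f₂ ≫ Y.T.mor₂ :=
  (exists_third f).choose_spec.1

theorem mor₂_third_assoc (f : X ⟶ Y) {A : C} (h : Y.T.obj₃ ⟶ A) :
    X.T.mor₂ ≫ third f ≫ h = f.f₂ ≫ Y.T.mor₂ ≫ h := by
  rw [← Category.assoc, mor₂_third, Category.assoc]

theorem third_mor₃ (f : X ⟶ Y) :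
    third f ≫ Y.T.mor₃ = X.T.mor₃ ≫ f.f₁⟦(1 : ℤ)⟧' :=
  (exists_third f).choose_spec.2.1

theorem third_mor₃_assoc (f : X ⟶ Y) {A : C} (h : Y.T.obj₁⟦(1 : ℤ)⟧ ⟶ A) :
    third f ≫ Y.T.mor₃ ≫ h = X.T.mor₃ ≫ f.f₁⟦(1 : ℤ)⟧' ≫ h := by
  rw [← Category.assoc, third_mor₃, Category.assoc]

theorem third_comm (f : X ⟶ Y) (i : ZMod N) :
    X.split₃.p i ≫ third f = third f ≫ Y.split₃.p i :=
  (exists_third f).choose_spec.2.2 i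

theorem eq_third (f : X ⟶ Y) (ψ : X.T.obj₃ ⟶ Y.T.obj₃) (h : X.T.mor₂ ≫ ψ = f.f₂ ≫ Y.T.mor₂)
    (hc : ∀ i, X.split₃.p i ≫ ψ = ψ ≫ Y.split₃.p i) : third f = ψ := by
  rw [← sub_eq_zero]
  apply eq_zero_of_comm
  · rw [Preadditive.comp_sub, mor₂_third, h, sub_self]
  · intro i
    rw [Preadditive.comp_sub, Preadditive.sub_comp, third_comm, hc]

/-- The functor from presentations to the triangulated category. -/
@[simps] noncomputable def toC (P : C) (N : ℕ) [NeZero N] [Fact (1 < N)] :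
    Presentation P N ⥤ C where
  obj X := X.T.obj₃
  map {X Y} f := third f + X.T.mor₃ ≫ f.u ≫ Y.T.mor₂
  map_id X := by
    rw [eq_third (𝟙 X) (𝟙 _) (by simp) (by simp)]
    simp
  map_comp {X Y Z} f g := by
    rw [eq_third (f ≫ g) (third f ≫ third g) (by
        rw [mor₂_third_assoc, mor₂_third, comp_f₂, Category.assoc]) (by
        intro i
        rw [← Category.assoc, third_comm, Category.assoc, third_comm, Category.assoc])]
    simp only [comp_u, Preadditive.add_comp, Preadditive.comp_add, Category.assoc,
      third_mor₃_assoc, mor₂_third, zero₂₃_assoc, zero_comp, comp_zero, add_zero]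
    abel

/-- The relation that two morphisms of presentations induce the same morphism. -/
def Rel (f g : X ⟶ Y) : Prop :=
  ∃ (h₁ : X.T.obj₂ ⟶ Y.T.obj₁) (h₂ : X.T.obj₂⟦(1 : ℤ)⟧ ⟶ Y.T.obj₂)
    (k₁ : X.T.obj₁⟦(1 : ℤ)⟧ ⟶ Y.T.obj₁),
    f.f₂ - g.f₂ = h₁ ≫ Y.T.mor₁ ∧ f.f₁ - g.f₁ = X.T.mor₁ ≫ h₁ ∧
      f.u - g.u = k₁ ≫ Y.T.mor₁ + X.T.mor₁⟦(1 : ℤ)⟧' ≫ h₂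

theorem third_eq_third (f g : X ⟶ Y) (h : (f.f₂ - g.f₂) ≫ Y.T.mor₂ = 0) :
    third f = third g := by
  refine eq_third f _ ?_ (third_comm g)
  rw [mor₂_third, eq_comm, ← sub_eq_zero, ← Preadditive.sub_comp, h]

theorem third_add_eq_iff (f g : X ⟶ Y) :
    third f + X.T.mor₃ ≫ f.u ≫ Y.T.mor₂ = third g + X.T.mor₃ ≫ g.u ≫ Y.T.mor₂ ↔ Rel f g := by
  constructor
  · intro h
    have h0 : (f.f₂ - g.f₂) ≫ Y.T.mor₂ = 0 := by
      have := congrArg (fun z => X.T.mor₂ ≫ z) h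
      simpa [mor₂_third, zero₂₃_assoc, Preadditive.sub_comp, sub_eq_zero] using this
    obtain ⟨h₁, hh₁⟩ := Triangle.coyoneda_exact₂ _ Y.dist _ h0
    have h2 : X.T.mor₃ ≫ (f.u - g.u) ≫ Y.T.mor₂ = 0 := by
      simpa [third_eq_third f g h0, Preadditive.sub_comp, sub_eq_zero] using h
    have h2' : X.T.rotate.mor₂ ≫ (f.u - g.u) ≫ Y.T.mor₂ = 0 := h2
    obtain ⟨b, hb⟩ := Triangle.yoneda_exact₃ _ (rot_of_distTriang _ X.dist) _ h2'
    obtain ⟨h₂, rfl⟩ := Y.factor_of_piFaithful X.good₂.piFaithful.shift b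
    replace hb : (f.u - g.u) ≫ Y.T.mor₂ = -(X.T.mor₁⟦(1 : ℤ)⟧' ≫ h₂ ≫ Y.T.mor₂) :=
      hb.trans (Preadditive.neg_comp _ _)
    obtain ⟨k₁, hk₁⟩ := Triangle.coyoneda_exact₂ _ Y.dist
      (f.u - g.u + X.T.mor₁⟦(1 : ℤ)⟧' ≫ h₂) (by
        rw [Preadditive.add_comp, hb, Category.assoc, neg_add_cancel])
    refine ⟨h₁, -h₂, k₁, hh₁, ?_, ?_⟩
    · apply X.good₁.piFaithful.ext
      intro n x
      rw [← sub_eq_zero, ← Preadditive.comp_sub]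
      apply Y.inj
      have e : X.T.mor₁ ≫ h₁ ≫ Y.T.mor₁ = (f.f₁ - g.f₁) ≫ Y.T.mor₁ := by
        rw [← hh₁, Preadditive.comp_sub, f.comm, g.comm, Preadditive.sub_comp]
      rw [Category.assoc, Preadditive.sub_comp, Category.assoc, e, sub_self, comp_zero]
    · rw [← hk₁]
      simp
  · rintro ⟨h₁, h₂, k₁, e₁, -, e₃⟩
    have h0 : (f.f₂ - g.f₂) ≫ Y.T.mor₂ = 0 := by
      rw [e₁, Category.assoc, zero₁₂, comp_zero]
    simp only [third_eq_third f g h0, add_right_inj]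
    rw [← sub_eq_zero, ← Preadditive.comp_sub, ← Preadditive.sub_comp, e₃]
    simp [zero₁₂, zero₃₁_assoc]

theorem toC_map_eq_iff (f g : X ⟶ Y) : (toC P N).map f = (toC P N).map g ↔ Rel f g :=
  third_add_eq_iff f g

theorem exists_third_add_eq (h : X.T.obj₃ ⟶ Y.T.obj₃) :
    ∃ t : X ⟶ Y, third t + X.T.mor₃ ≫ t.u ≫ Y.T.mor₂ = h := by
  obtain ⟨f₂, hf₂⟩ := Y.factor_of_piFaithful X.good₂.piFaithful (X.T.mor₂ ≫ h)
  obtain ⟨f₁, hf₁⟩ := Triangle.coyoneda_exact₂ _ Y.dist (X.T.mor₁ ≫ f₂) (by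
    rw [Category.assoc, ← hf₂, zero₁₂_assoc, zero_comp])
  let t₀ : X ⟶ Y := ⟨f₁, f₂, 0, hf₁⟩
  obtain ⟨a, ha⟩ := Triangle.yoneda_exact₃ _ X.dist (h - third t₀) (by
    rw [Preadditive.comp_sub, mor₂_third, hf₂]
    exact sub_self _)
  obtain ⟨u, rfl⟩ := Y.factor_of_piFaithful X.good₁.piFaithful.shift a
  let t : X ⟶ Y := ⟨f₁, f₂, u, hf₁⟩
  have ht : third t = third t₀ := third_eq_third _ _ (by simp [t₀, t])
  refine ⟨t, ?_⟩
  rw [ht]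
  change third t₀ + X.T.mor₃ ≫ u ≫ Y.T.mor₂ = h
  rw [← ha]
  abel

instance toC_full : (toC P N).Full where
  map_surjective := exists_third_add_eq

end

end

end Presentation

theorem isIso_of_pi_bijective {P : C} (hgen : IsGenerator P) {X Y : C} (φ : X ⟶ Y)
    (h : ∀ n : ℤ, Function.Bijective (fun x : P⟦n⟧ ⟶ X => x ≫ φ)) : IsIso φ := by
  obtain ⟨Z, a, b, hT⟩ := distinguished_cocone_triangle φ
  refine (Triangle.isZero₃_iff_isIso₁ _ hT).mp ?_
  apply hgen
  intro n x
  have h1 : x ≫ b = 0 := comp_mor₃_eq_zero hT (fun n y hy => (h n).1 (hy.trans zero_comp.symm)) x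
  obtain ⟨y, hy⟩ := Triangle.coyoneda_exact₃ _ hT x h1
  obtain ⟨w, rfl⟩ := (h n).2 y
  rw [hy]
  have h0 : φ ≫ a = 0 := comp_distTriang_mor_zero₁₂ _ hT
  change (w ≫ φ) ≫ a = 0
  rw [Category.assoc, h0, comp_zero]

namespace Presentation

theorem toC_essSurj [Fact (1 < N)] (hgen : IsGenerator P)
    (hex : ∀ A : GradedModule P, ∃ X : Presentation P N, Nonempty (GIso (piMod P X.T.obj₃) A)) :
    (toC P N).EssSurj where
  mem_essImage Y := by
    obtain ⟨X, ⟨θ⟩⟩ := hex (piMod P Y)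
    obtain ⟨f, hf⟩ := X.good₂.exists_hom (θ.hom.comp (piGHom P X.T.mor₂))
    obtain ⟨φ, hφ⟩ := Triangle.yoneda_exact₂ _ X.dist f (by
      apply X.good₁.piFaithful
      intro n x
      rw [← Category.assoc, hf, GHom.comp_app, piGHom_app, Category.assoc, zero₁₂, comp_zero,
        map_zero])
    have h : ∀ (n : ℤ) (x : P⟦n⟧ ⟶ X.T.obj₃), x ≫ φ = θ.hom.app n x := by
      intro n x
      obtain ⟨y, rfl⟩ := X.exists_lift_mor₂ x
      rw [Category.assoc, ← hφ, hf]
      rfl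
    have : IsIso φ := by
      apply isIso_of_pi_bijective hgen
      intro n
      have e : (fun x : P⟦n⟧ ⟶ X.T.obj₃ => x ≫ φ) = θ.hom.app n := funext (h n)
      rw [e]
      exact Function.bijective_iff_has_inverse.mpr ⟨θ.inv.app n,
        fun x => GHom.congr_app θ.hom_inv_id x, fun x => GHom.congr_app θ.inv_hom_id x⟩
    exact ⟨X, ⟨@asIso _ _ X.T.obj₃ Y φ this⟩⟩

end Presentation

end Presentations

section Coproducts

/-- The comparison map `⊕ᵢ Hom(A, Xᵢ) → Hom(A, c)` for a cofan `c`. -/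
noncomputable def cofanComparison (A : C) {ι : Type v} {X : ι → C} (c : Cofan X) :
    (⨁ i, (A ⟶ X i)) →+ (A ⟶ c.pt) := by
  classical
  exact DirectSum.toAddMonoid fun i =>
    AddMonoidHom.mk' (fun f => f ≫ c.inj i) (fun f g => Preadditive.add_comp _ _ _ _ _ _)

theorem cofanComparison_of (A : C) {ι : Type v} {X : ι → C} (c : Cofan X) [DecidableEq ι] (i : ι)
    (f : A ⟶ X i) : cofanComparison A c (DirectSum.of _ i f) = f ≫ c.inj i := by
  rw [cofanComparison]
  convert DirectSum.toAddMonoid_of (β := fun i => (A ⟶ X i)) _ i f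
  rfl

variable [HasCoproducts.{v} C] {P : C}

theorem IsCompactObj.cofanComparison_bijective (hP : IsCompactObj P) {ι : Type v} {X : ι → C}
    {c : Cofan X} (hc : IsColimit c) : Function.Bijective (cofanComparison P c) := by
  classical
  let e : ∐ X ≅ c.pt := (coproductIsCoproduct X).coconePointUniqueUpToIso hc
  have he : ∀ i, Sigma.ι X i ≫ e.hom = c.inj i := fun i =>
    IsColimit.comp_coconePointUniqueUpToIso_hom (coproductIsCoproduct X) hc ⟨i⟩
  have h : ⇑(cofanComparison P c) = (fun x => x ≫ e.hom) ∘ compactComparison P X := by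
    have : cofanComparison P c = (AddMonoidHom.mk' (fun x : P ⟶ ∐ X => x ≫ e.hom)
        (fun f g => Preadditive.add_comp _ _ _ _ _ _)).comp (compactComparison P X) := by
      apply DirectSum.addHom_ext
      intro i f
      rw [cofanComparison_of, AddMonoidHom.comp_apply, compactComparison]
      erw [DirectSum.toAddMonoid_of]
      simp [he]
    exact congrArg DFunLike.coe this
  rw [h]
  exact (e.homToEquiv).bijective.comp (hP ι X)

theorem IsCompactObj.cofanComparison_shift_bijective (hP : IsCompactObj P) (n : ℤ) {ι : Type v}
    {X : ι → C} {c : Cofan X} (hc : IsColimit c) :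
    Function.Bijective (cofanComparison (P⟦n⟧) c) := by
  classical
  let G := shiftFunctor C (-n)
  let c' : Cofan (fun i => G.obj (X i)) := Cofan.mk (G.obj c.pt) fun i => G.map (c.inj i)
  have hc' : IsColimit c' := isColimitCofanMkObjOfIsColimit G _ _
    (hc.ofIsoColimit (Cofan.ext (Iso.refl _)))
  let s : P ⟶ G.obj (P⟦n⟧) := (shiftFunctorCompIsoId C n (-n) (by omega)).inv.app P
  let e : ∀ Y : C, (P⟦n⟧ ⟶ Y) →+ (P ⟶ G.obj Y) := fun Y =>
    AddMonoidHom.mk' (fun f => s ≫ G.map f) fun f g => by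
      simp [G, Functor.map_add, Preadditive.comp_add]
  have he : ∀ Y, Function.Bijective (e Y) := by
    intro Y
    have : IsIso s := inferInstance
    exact (asIso s).homFromEquiv.symm.bijective.comp
      ((Functor.FullyFaithful.ofFullyFaithful G).map_bijective _ _)
  have h : (e c.pt).comp (cofanComparison (P⟦n⟧) c) =
      (cofanComparison P c').comp (DirectSum.map fun i => e (X i)) := by
    apply DirectSum.addHom_ext
    intro i f
    rw [AddMonoidHom.comp_apply, AddMonoidHom.comp_apply, cofanComparison_of, DirectSum.map_of,
      cofanComparison_of]
    change s ≫ G.map (f ≫ c.inj i) = (s ≫ G.map f) ≫ G.map (c.inj i)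
    rw [Functor.map_comp, Category.assoc]
  have hb : Function.Bijective ((e c.pt).comp (cofanComparison (P⟦n⟧) c)) := by
    rw [h]
    exact (hP.cofanComparison_bijective hc').comp
      ⟨(DirectSum.map_injective _).2 fun i => (he _).1,
        (DirectSum.map_surjective _).2 fun i => (he _).2⟩
  exact (Function.Bijective.of_comp_iff' (he _) _).1 hb

theorem IsCompactObj.exists_coprod_desc (hP : IsCompactObj P) {ι : Type v} (X : ι → C)
    (M : GradedModule P) (φ : ∀ i, GHom (piMod P (X i)) M) :
    ∃ F : GHom (piMod P (∐ X)) M, ∀ i n x, F.app n (x ≫ Sigma.ι X i) = (φ i).app n x := by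
  classical
  let c : Cofan X := Cofan.mk (∐ X) (Sigma.ι X)
  have hc : IsColimit c := coproductIsCoproduct X
  let e : ∀ n : ℤ, (⨁ i, (P⟦n⟧ ⟶ X i)) ≃+ (P⟦n⟧ ⟶ ∐ X) := fun n =>
    AddEquiv.ofBijective _ (hP.cofanComparison_shift_bijective n hc)
  have he : ∀ n i x, e n (DirectSum.of _ i x) = x ≫ Sigma.ι X i := fun n i x =>
    cofanComparison_of _ c i x
  let F : ∀ n : ℤ, (P⟦n⟧ ⟶ ∐ X) →+ M.M n := fun n =>
    (DirectSum.toAddMonoid fun i => (φ i).app n).comp (e n).symm.toAddMonoidHom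
  have hF : ∀ i n x, F n (x ≫ Sigma.ι X i) = (φ i).app n x := by
    intro i n x
    change DirectSum.toAddMonoid (fun i => (φ i).app n) ((e n).symm (x ≫ Sigma.ι X i)) = _
    rw [← he, AddEquiv.symm_apply_apply, DirectSum.toAddMonoid_of]
  refine ⟨⟨F, fun {n k l} h m a => ?_⟩, hF⟩
  obtain ⟨y, rfl⟩ := (e n).surjective m
  induction y using DirectSum.induction_on with
  | zero => rw [map_zero, GradedModule.zero_smulₓ, map_zero, map_zero, GradedModule.zero_smulₓ]
  | of i x =>
    rw [he, hF]
    have : (piMod P (∐ X)).smul h (x ≫ Sigma.ι X i) a = (piMod P (X i)).smul h x a ≫ Sigma.ι X i :=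
      ((piGHom P (Sigma.ι X i)).app_smul h x a).symm
    rw [this, hF, (φ i).app_smul]
  | add x y hx hy =>
    rw [map_add, GradedModule.add_smulₓ, map_add, map_add, GradedModule.add_smulₓ, hx, hy]

theorem IsCompactObj.coprod_hom_ext (hP : IsCompactObj P) {ι : Type v} (X : ι → C)
    {M : GradedModule P} {F G : GHom (piMod P (∐ X)) M}
    (h : ∀ i n x, F.app n (x ≫ Sigma.ι X i) = G.app n (x ≫ Sigma.ι X i)) : F = G := by
  classical
  ext n x
  let c : Cofan X := Cofan.mk (∐ X) (Sigma.ι X)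
  obtain ⟨y, rfl⟩ := (hP.cofanComparison_shift_bijective n (c := c) (coproductIsCoproduct X)).2 x
  induction y using DirectSum.induction_on with
  | zero => rw [map_zero, map_zero, map_zero]
  | of i x =>
    rw [cofanComparison_of]
    exact h i n x
  | add x y hx hy => rw [map_add, map_add, map_add, hx, hy]

theorem IsCompactObj.good_coprod (hP : IsCompactObj P) {ι : Type v} {X : ι → C}
    (hX : ∀ i, Good P (X i)) : Good P (∐ X) := by
  apply good_of_exists
  · intro Y a ha
    refine Sigma.hom_ext _ _ fun i => ?_
    rw [comp_zero]
    apply (hX i).piFaithful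
    intro n x
    rw [← Category.assoc, ha]
  · intro Y F
    choose f hf using fun i => (hX i).exists_hom (F.comp (piGHom P (Sigma.ι X i)))
    refine ⟨Sigma.desc f, fun n x => ?_⟩
    have : piGHom P (Sigma.desc f) = F := by
      apply hP.coprod_hom_ext
      intro i n x
      rw [piGHom_app, Category.assoc, Sigma.ι_desc, hf]
      rfl
    exact GHom.congr_app this x

end Coproducts

section Yoneda

variable {P : C}

theorem gsmulHom_id_bijective (P : C) {n k l : ℤ} (h : n + k = l) :
    Function.Bijective (fun a : lam P k => gsmulHom P h (𝟙 (P⟦n⟧)) a) := by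
  have e : (fun a : lam P k => gsmulHom P h (𝟙 (P⟦n⟧)) a) =
      fun a => ((shiftFunctorAdd' C k n l (by omega)).app P).hom ≫ (shiftFunctor C n).map a := by
    funext a
    simp [gsmulHom]
  rw [e]
  exact ((shiftFunctorAdd' C k n l (by omega)).app P).homFromEquiv.symm.bijective.comp
    ((Functor.FullyFaithful.ofFullyFaithful (shiftFunctor C n)).map_bijective _ _)

theorem piMod_shift_hom_ext {k : ℤ} {M : GradedModule P} {F G : GHom (piMod P (P⟦k⟧)) M}
    (h : F.app k (𝟙 (P⟦k⟧)) = G.app k (𝟙 (P⟦k⟧))) : F = G := by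
  ext n x
  obtain ⟨a, rfl⟩ := (gsmulHom_id_bijective P (show k + (n - k) = n by omega)).2 x
  have hk : k + (n - k) = n := by omega
  exact (F.app_smul hk _ a).trans
    ((congrArg (fun y => M.smul hk y a) h).trans (G.app_smul hk _ a).symm)

theorem GradedModule.smul_eq_self (M : GradedModule P) {k j : ℤ} (h : k + j = k) (m : M.M k)
    (b : lam P j) (hb : gsmulHom P h (𝟙 (P⟦k⟧)) b = 𝟙 _) : M.smul h m b = m := by
  obtain rfl : j = 0 := by omega
  have : b = gone P := (gsmulHom_id_bijective P h).1
    (hb.trans ((piMod P (P⟦k⟧)).smul_oneₓ (𝟙 (P⟦k⟧))).symm)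
  rw [this]
  exact M.smul_oneₓ m

theorem exists_piMod_shift_hom {k : ℤ} (M : GradedModule P) (m : M.M k) :
    ∃ F : GHom (piMod P (P⟦k⟧)) M, F.app k (𝟙 (P⟦k⟧)) = m := by
  let θ := fun n : ℤ => Equiv.ofBijective _
    (gsmulHom_id_bijective P (show k + (n - k) = n by omega))
  have hθ : ∀ {n : ℤ} (x : P⟦n⟧ ⟶ P⟦k⟧),
      (piMod P (P⟦k⟧)).smul (show k + (n - k) = n by omega) (𝟙 (P⟦k⟧)) ((θ n).symm x) = x :=
    fun x => (θ _).apply_symm_apply x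
  refine ⟨⟨fun n => AddMonoidHom.mk' (fun x => M.smul (by omega) m ((θ n).symm x)) ?_, ?_⟩, ?_⟩
  · intro x y
    rw [← M.smul_addₓ]
    congr 1
    apply (θ n).injective
    rw [Equiv.apply_symm_apply]
    conv_lhs => rw [← hθ x, ← hθ y, ← GradedModule.smul_addₓ]
    rfl
  · intro n j l h x a
    change M.smul _ m ((θ l).symm _) = M.smul h (M.smul _ m ((θ n).symm x)) a
    rw [M.smul_mulₓ _ (show (n - k) + j = l - k by omega) h (by omega)]
    congr 1
    apply (θ l).injective
    rw [Equiv.apply_symm_apply]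
    conv_lhs => rw [← hθ x]
    rw [GradedModule.smul_mulₓ _ _ (show (n - k) + j = l - k by omega) h (by omega)]
    rfl
  · change M.smul _ m ((θ k).symm (𝟙 (P⟦k⟧))) = m
    exact M.smul_eq_self _ _ _ (hθ _)

theorem good_shift (k : ℤ) : Good P (P⟦k⟧) := by
  apply good_of_exists
  · intro Y a ha
    rw [← Category.id_comp a, ha]
  · intro Y F
    refine ⟨F.app k (𝟙 _), fun n x => ?_⟩
    have : piGHom P (F.app k (𝟙 (P⟦k⟧)) : P⟦k⟧ ⟶ Y) = F := piMod_shift_hom_ext (by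
      rw [piGHom_app, Category.id_comp])
    exact GHom.congr_app this x

end Yoneda

section IdempotentSplitting

theorem exists_complement {L M : C} {i : L ⟶ M} {p : M ⟶ L} (hip : i ≫ p = 𝟙 L) :
    ∃ (Y : C) (q : M ⟶ Y) (t : Y ⟶ M), t ≫ q = 𝟙 Y ∧ 𝟙 M - p ≫ i = q ≫ t := by
  obtain ⟨Y, q, δ, hT⟩ := distinguished_cocone_triangle i
  have hδ : δ = 0 := by
    have h : δ ≫ i⟦(1 : ℤ)⟧' = 0 := comp_distTriang_mor_zero₃₁ _ hT
    have h' : (i⟦(1 : ℤ)⟧') ≫ p⟦(1 : ℤ)⟧' = 𝟙 _ := by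
      rw [← Functor.map_comp, hip, CategoryTheory.Functor.map_id]
    rw [← Category.comp_id δ, ← h', ← Category.assoc, h, zero_comp]
  have hiq : i ≫ q = 0 := comp_distTriang_mor_zero₁₂ _ hT
  obtain ⟨s, hs⟩ : ∃ s : Y ⟶ M, 𝟙 Y = s ≫ q := Triangle.coyoneda_exact₃ _ hT (𝟙 Y) (by
    change 𝟙 Y ≫ δ = 0
    rw [hδ, comp_zero])
  obtain ⟨t, ht⟩ : ∃ t : Y ⟶ M, 𝟙 M - p ≫ i = q ≫ t :=
    Triangle.yoneda_exact₂ _ hT (𝟙 _ - p ≫ i) (by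
      change i ≫ (𝟙 _ - p ≫ i) = 0
      rw [Preadditive.comp_sub, ← Category.assoc, hip, Category.id_comp, Category.comp_id,
        sub_self])
  have h : q ≫ t ≫ q = q := by
    rw [← Category.assoc, ← ht, Preadditive.sub_comp, Category.assoc, hiq, comp_zero, sub_zero,
      Category.id_comp]
  refine ⟨Y, q, t, ?_, ht⟩
  rw [← Category.id_comp (t ≫ q), hs, Category.assoc, h]

variable [HasCoproducts.{v} C]

/-- Idempotents split in a triangulated category with countable coproducts. -/
theorem exists_splitting_of_idempotent {X : C} (e : X ⟶ X) (he : e ≫ e = e) :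
    ∃ (Y : C) (a : Y ⟶ X) (b : X ⟶ Y), a ≫ b = 𝟙 Y ∧ b ≫ a = e := by
  let F : ULift.{v} ℕ → C := fun _ => X
  let ι : ℕ → (X ⟶ ∐ F) := fun n => Sigma.ι F ⟨n⟩
  let desc : ∀ {Z : C}, (ℕ → (X ⟶ Z)) → (∐ F ⟶ Z) := fun g => Sigma.desc fun n => g n.down
  have ι_desc : ∀ {Z : C} (g : ℕ → (X ⟶ Z)) (n : ℕ), ι n ≫ desc g = g n := fun g n =>
    Sigma.ι_desc _ _
  have ext : ∀ {Z : C} {g h : ∐ F ⟶ Z}, (∀ n, ι n ≫ g = ι n ≫ h) → g = h := fun h =>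
    Sigma.hom_ext _ _ fun n => h n.down
  let gi : ℕ → (X ⟶ ∐ F) := fun n => ι n - e ≫ ι n + e ≫ ι (n + 1)
  let i : ∐ F ⟶ ∐ F := desc gi
  let p : ∐ F ⟶ ∐ F := desc fun n => Nat.casesOn n (ι 0 - e ≫ ι 0)
    fun n => ι (n + 1) - e ≫ ι (n + 1) + e ≫ ι n
  have hi : ∀ n, ι n ≫ i = ι n - e ≫ ι n + e ≫ ι (n + 1) := fun n => ι_desc gi n
  have hp0 : ι 0 ≫ p = ι 0 - e ≫ ι 0 := ι_desc _ 0
  have hp : ∀ n, ι (n + 1) ≫ p = ι (n + 1) - e ≫ ι (n + 1) + e ≫ ι n := fun n => ι_desc _ (n + 1)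
  have hee : ∀ {Z : C} (g : X ⟶ Z), e ≫ e ≫ g = e ≫ g := fun g => by
    rw [← Category.assoc, he]
  have hip : i ≫ p = 𝟙 _ := by
    apply ext
    intro n
    rw [← Category.assoc, hi, Category.comp_id]
    cases n with
    | zero => simp [Preadditive.add_comp, Preadditive.sub_comp, Preadditive.comp_add,
        Preadditive.comp_sub, hp0, hp, hee]
    | succ n => simp [Preadditive.add_comp, Preadditive.sub_comp, Preadditive.comp_add,
        Preadditive.comp_sub, hp, hee]
  let d : ∐ F ⟶ X := desc fun n => Nat.casesOn n (𝟙 X) fun _ => 0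
  have hd0 : ι 0 ≫ d = 𝟙 X := ι_desc _ 0
  have hd : ∀ n, ι (n + 1) ≫ d = 0 := fun n => ι_desc _ (n + 1)
  have hpi : 𝟙 _ - p ≫ i = d ≫ e ≫ ι 0 := by
    apply ext
    intro n
    rw [Preadditive.comp_sub, Category.comp_id, ← Category.assoc, ← Category.assoc]
    cases n with
    | zero => simp [Preadditive.sub_comp, Preadditive.comp_add,
        Preadditive.comp_sub, hp0, hd0, hi, hee]
    | succ n => simp [Preadditive.add_comp, Preadditive.sub_comp, Preadditive.comp_add,
        Preadditive.comp_sub, hp, hd, hi, hee]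
  obtain ⟨Y, q, t, htq, ht⟩ := exists_complement hip
  rw [hpi] at ht
  refine ⟨Y, t ≫ d ≫ e, ι 0 ≫ q, ?_, ?_⟩
  · calc (t ≫ d ≫ e) ≫ ι 0 ≫ q = t ≫ (d ≫ e ≫ ι 0) ≫ q := by simp only [Category.assoc]
      _ = 𝟙 Y := by rw [ht, Category.assoc, htq, Category.comp_id, htq]
  · calc (ι 0 ≫ q) ≫ t ≫ d ≫ e = ι 0 ≫ (q ≫ t) ≫ d ≫ e := by simp only [Category.assoc]
      _ = e := by
        rw [← ht, Category.assoc, Category.assoc, ← Category.assoc (ι 0) d, hd0, Category.id_comp,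
          ← Category.assoc (ι 0) d, hd0, Category.id_comp, he]

end IdempotentSplitting

section Realization

variable {P : C}

theorem IsCompactObj.exists_surj [HasCoproducts.{v} C] (hP : IsCompactObj P) (M : GradedModule P) :
    ∃ (X : C) (F : GHom (piMod P X) M), Good P X ∧ F.Surj := by
  choose φ hφ using fun j : (Σ n : ℤ, M.M n) => exists_piMod_shift_hom M j.2
  obtain ⟨F, hF⟩ := hP.exists_coprod_desc (fun j : (Σ n : ℤ, M.M n) => P⟦j.1⟧) M φ
  refine ⟨_, F, hP.good_coprod fun j => good_shift j.1, fun n m => ?_⟩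
  exact ⟨_, (hF ⟨n, m⟩ n (𝟙 _)).trans (hφ ⟨n, m⟩)⟩

theorem Good.exists_splitting [HasCoproducts.{v} C] {X : C} (hX : Good P X)
    (E : GHom (piMod P X) (piMod P X)) (hE : ∀ n x, E.app n (E.app n x) = E.app n x) :
    ∃ (Y : C) (a : Y ⟶ X) (b : X ⟶ Y), a ≫ b = 𝟙 Y ∧
      ∀ (n : ℤ) (x : P⟦n⟧ ⟶ X), x ≫ b ≫ a = E.app n x := by
  obtain ⟨e, he⟩ := hX.exists_hom E
  obtain ⟨Y, a, b, hab, hba⟩ := exists_splitting_of_idempotent e (by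
    apply hX.piFaithful.ext
    intro n x
    rw [← Category.assoc, he, he, hE])
  exact ⟨Y, a, b, hab, fun n x => by rw [hba, he]⟩

theorem IsCompactObj.exists_realization [HasCoproducts.{v} C] (hP : IsCompactObj P)
    {Q : GradedModule P} (hQ : IsProjective Q) :
    ∃ X : C, Good P X ∧ Nonempty (GIso (piMod P X) Q) := by
  obtain ⟨X, F, hX, hF⟩ := hP.exists_surj Q
  obtain ⟨G, hG⟩ := hQ _ _ F hF (GHom.id Q)
  have hFG : ∀ n y, F.app n (G.app n y) = y := fun n y => GHom.congr_app hG y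
  obtain ⟨Y, a, b, hab, hba⟩ := hX.exists_splitting (G.comp F) fun n x => by
    exact congrArg (G.app n) (hFG n _)
  refine ⟨Y, hX.of_retract a b hab, ⟨⟨F.comp (piGHom P a), (piGHom P b).comp G, ?_, ?_⟩⟩⟩
  · ext n y
    change G.app n (F.app n (y ≫ a)) ≫ b = y
    rw [← GHom.comp_app, ← hba, Category.assoc, Category.assoc, Category.assoc, hab,
      Category.comp_id, hab, Category.comp_id]
  · ext n y
    change F.app n ((G.app n y ≫ b) ≫ a) = y
    rw [Category.assoc, hba, GHom.comp_app, hFG, hFG]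

theorem IsProjective.of_retract {Q R : GradedModule P} (hQ : IsProjective Q) (i : GHom R Q)
    (p : GHom Q R) (h : ∀ n x, p.app n (i.app n x) = x) : IsProjective R := by
  intro A B e he f
  obtain ⟨g, hg⟩ := hQ A B e he (f.comp p)
  refine ⟨g.comp i, ?_⟩
  ext n x
  have := GHom.congr_app hg (i.app n x)
  simp only [GHom.comp_app, h] at this ⊢
  exact this

theorem GradedModule.smul_zero (M : GradedModule P) {n k l : ℤ} (h : n + k = l) (m : M.M n) :
    M.smul h m 0 = 0 := by
  have := M.smul_addₓ h m 0 0
  rwa [add_zero, left_eq_add] at this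

open Classical in
/-- The projection of a graded module onto the degrees congruent to `i` modulo `N`. -/
def GradedModule.degProj {N : ℕ} (hsp : Sparse P N) (i : ZMod N) (M : GradedModule P) :
    GHom M M where
  app n := if (n : ZMod N) = i then AddMonoidHom.id _ else 0
  app_smul {n k l} h m a := by
    by_cases hk : (N : ℤ) ∣ k
    · have : (l : ZMod N) = n := by
        rw [← h, Int.cast_add, (ZMod.intCast_zmod_eq_zero_iff_dvd k N).2 hk, add_zero]
      rw [this]
      split_ifs
      · rfl
      · exact (M.zero_smulₓ h a).symm
    · rw [hsp k hk a, M.smul_zero, M.smul_zero, map_zero]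

open Classical in
theorem GradedModule.degProj_app {N : ℕ} (hsp : Sparse P N) (i : ZMod N) (M : GradedModule P)
    (n : ℤ) (x : M.M n) : (M.degProj hsp i).app n x = if (n : ZMod N) = i then x else 0 := by
  simp only [degProj]
  split_ifs <;> rfl

theorem GradedModule.degProj_degProj {N : ℕ} (hsp : Sparse P N) (i : ZMod N) (M : GradedModule P)
    (n : ℤ) (x : M.M n) :
    (M.degProj hsp i).app n ((M.degProj hsp i).app n x) = (M.degProj hsp i).app n x := by
  simp only [degProj_app]
  split_ifs <;> rfl

/-- A decomposition of an object according to the degrees of its homotopy module modulo `N`. -/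
structure Decomposition (P : C) (N : ℕ) (X : C) where
  Y : ZMod N → C
  a : ∀ i, Y i ⟶ X
  b : ∀ i, X ⟶ Y i
  a_b : ∀ i, a i ≫ b i = 𝟙 _
  b_a_self : ∀ (n : ℤ) (x : P⟦n⟧ ⟶ X), x ≫ b n ≫ a n = x
  b_eq_zero : ∀ (n : ℤ) (i : ZMod N) (x : P⟦n⟧ ⟶ X), (n : ZMod N) ≠ i → x ≫ b i = 0

theorem Good.nonempty_decomposition [HasCoproducts.{v} C] {N : ℕ} (hsp : Sparse P N)
    {X : C} (hX : Good P X) : Nonempty (Decomposition P N X) := by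
  classical
  choose Y a b hab hba using fun i : ZMod N =>
    hX.exists_splitting ((piMod P X).degProj hsp i) (GradedModule.degProj_degProj hsp i _)
  refine ⟨⟨Y, a, b, hab, fun n x => ?_, fun n i x hi => ?_⟩⟩
  · rw [hba, GradedModule.degProj_app, if_pos rfl]
  · have := hba i n x
    rw [GradedModule.degProj_app, if_neg hi] at this
    rw [← Category.comp_id (b i), ← hab, reassoc_of% this, zero_comp]

theorem GIso.nonempty_of_surj {M A B : GradedModule P} (s : GHom M A) (t : GHom M B) (hs : s.Surj)
    (ht : t.Surj) (h : ∀ n x, s.app n x = 0 ↔ t.app n x = 0) : Nonempty (GIso A B) := by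
  have key : ∀ {A B : GradedModule P} (s : GHom M A) (t : GHom M B), s.Surj →
      (∀ n x, s.app n x = 0 → t.app n x = 0) →
      ∃ F : GHom A B, ∀ n x, F.app n (s.app n x) = t.app n x := by
    intro A B s t hs h
    choose σ hσ using hs
    have h' : ∀ n x y, s.app n x = s.app n y → t.app n x = t.app n y := by
      intro n x y hxy
      rw [← sub_eq_zero, ← map_sub]
      apply h
      rw [map_sub, hxy, sub_self]
    refine ⟨⟨fun n => AddMonoidHom.mk' (fun x => t.app n (σ n x)) fun x y => ?_,
      fun {n k l} e m a => ?_⟩, fun n x => h' _ _ _ (hσ _ _)⟩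
    · rw [← map_add]
      apply h'
      rw [hσ, map_add, hσ, hσ]
    · change t.app l (σ l _) = B.smul e (t.app n (σ n m)) a
      rw [← t.app_smul]
      apply h'
      rw [hσ, s.app_smul, hσ]
  obtain ⟨F, hF⟩ := key s t hs fun n x => (h n x).1
  obtain ⟨G, hG⟩ := key t s ht fun n x => (h n x).2
  refine ⟨⟨F, G, ?_, ?_⟩⟩
  · ext n x
    obtain ⟨y, rfl⟩ := hs n x
    rw [GHom.comp_app, hF, hG, GHom.id_app]
  · ext n x
    obtain ⟨y, rfl⟩ := ht n x
    rw [GHom.comp_app, hG, hF, GHom.id_app]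

end Realization

section ProductPresentation

variable {P : C} {N : ℕ} [NeZero N]

/-- The projection of a product onto one of its factors, as an endomorphism. -/
noncomputable def factorProj (X : ZMod N → C) (i : ZMod N) : ∏ᶜ X ⟶ ∏ᶜ X :=
  Limits.Pi.map fun j => if j = i then 𝟙 (X j) else 0

theorem factorProj_π (X : ZMod N → C) (i j : ZMod N) :
    factorProj X i ≫ Pi.π X j = if j = i then Pi.π X j else 0 := by
  rw [factorProj, Limits.Pi.map_π]
  split_ifs
  · exact Category.comp_id _
  · exact comp_zero

theorem factorProj_comp (X : ZMod N → C) (i j : ZMod N) :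
    factorProj X i ≫ factorProj X j = if i = j then factorProj X i else 0 := by
  refine Pi.hom_ext _ _ fun k => ?_
  rw [Category.assoc, factorProj_π]
  by_cases hij : i = j
  · subst hij
    rw [if_pos rfl, factorProj_π]
    split_ifs with h
    · rw [factorProj_π, if_pos h]
    · exact comp_zero
  · rw [if_neg hij, zero_comp]
    split_ifs with h
    · rw [factorProj_π, if_neg]
      rintro rfl
      exact hij h
    · exact comp_zero

/-- The splitting of a product whose factors have homotopy concentrated in different degrees. -/
noncomputable def productSplitting (X : ZMod N → C)
    (h : ∀ (j : ZMod N) (n : ℤ), (n : ZMod N) ≠ j → ∀ x : P⟦n⟧ ⟶ X j, x = 0) :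
    Splitting P N (∏ᶜ X) where
  p := factorProj X
  sum_eq := by
    refine Pi.hom_ext _ _ fun j => ?_
    rw [Preadditive.sum_comp, Category.id_comp, Finset.sum_congr rfl fun i _ => factorProj_π X i j]
    simp
  comp_eq_zero i n hn x := by
    refine Pi.hom_ext _ _ fun j => ?_
    rw [Category.assoc, factorProj_π, zero_comp]
    split_ifs with hj
    · subst hj
      exact h j n hn _
    · exact comp_zero

namespace Decomposition

variable {X : C} (D : Decomposition P N X)

theorem eq_zero {i : ZMod N} {n : ℤ} (hn : (n : ZMod N) ≠ i) (x : P⟦n⟧ ⟶ D.Y i) : x = 0 := by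
  rw [← Category.comp_id x, ← D.a_b, ← Category.assoc, D.b_eq_zero n i _ hn]

theorem a_b_of_ne (hX : Good P X) {i j : ZMod N} (hij : i ≠ j) : D.a i ≫ D.b j = 0 := by
  apply (hX.of_retract (D.a i) (D.b i) (D.a_b i)).piFaithful
  intro n x
  by_cases hn : (n : ZMod N) = i
  · rw [← Category.assoc, D.b_eq_zero n j _ (by rwa [hn])]
  · rw [D.eq_zero hn x, zero_comp]

/-- An object is the product of the pieces of a decomposition. -/
noncomputable def iso (hX : Good P X) : X ≅ ∏ᶜ D.Y where
  hom := Pi.lift D.b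
  inv := ∑ i, Pi.π D.Y i ≫ D.a i
  hom_inv_id := by
    apply hX.piFaithful.ext
    intro n x
    rw [Preadditive.comp_sum, Preadditive.comp_sum, Category.comp_id,
      Finset.sum_eq_single (n : ZMod N)]
    · rw [Pi.lift_π_assoc, D.b_a_self]
    · intro i _ hi
      rw [Pi.lift_π_assoc, ← Category.assoc, D.b_eq_zero n i x hi.symm, zero_comp]
    · exact fun h => absurd (Finset.mem_univ _) h
  inv_hom_id := by
    refine Pi.hom_ext _ _ fun j => ?_
    rw [Category.assoc, Pi.lift_π, Category.id_comp, Preadditive.sum_comp,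
      Finset.sum_eq_single j]
    · rw [Category.assoc, D.a_b, Category.comp_id]
    · intro i _ hi
      rw [Category.assoc, D.a_b_of_ne hX hi, comp_zero]
    · exact fun h => absurd (Finset.mem_univ _) h

theorem iso_hom_π (hX : Good P X) (j : ZMod N) : (D.iso hX).hom ≫ Pi.π D.Y j = D.b j :=
  Pi.lift_π _ _

theorem comp_b {Y : C} (D' : Decomposition P N Y) (hX : Good P X) (f : X ⟶ Y) (j : ZMod N) :
    D.b j ≫ D.a j ≫ f ≫ D'.b j = f ≫ D'.b j := by
  apply hX.piFaithful.ext
  intro n x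
  by_cases hn : (n : ZMod N) = j
  · subst hn
    rw [← Category.assoc, ← Category.assoc, Category.assoc x, D.b_a_self]
  · rw [← Category.assoc, D.b_eq_zero n j x hn, zero_comp, ← Category.assoc,
      D'.b_eq_zero n j _ hn]

end Decomposition

theorem IsProjective.of_iso {X Y : C} (hX : IsProjective (piMod P X)) (e : X ≅ Y) :
    IsProjective (piMod P Y) :=
  hX.of_retract (piGHom P e.inv) (piGHom P e.hom) fun n x => by
    rw [piGHom_app, piGHom_app, Category.assoc, e.inv_hom_id, Category.comp_id]

theorem exists_presentation_of_triangles {T : ZMod N → Triangle C} (hT : ∀ j, T j ∈ distTriang C)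
    {X Y : C} (f : X ⟶ Y) (e₁ : X ≅ ∏ᶜ fun j => (T j).obj₁) (e₂ : Y ≅ ∏ᶜ fun j => (T j).obj₂)
    (comm : e₁.hom ≫ Limits.Pi.map (fun j => (T j).mor₁) = f ≫ e₂.hom)
    (good₁ : Good P X) (good₂ : Good P Y) (proj₁ : IsProjective (piMod P X))
    (proj₂ : IsProjective (piMod P Y)) (inj : ∀ (n : ℤ) (x : P⟦n⟧ ⟶ X), x ≫ f = 0 → x = 0)
    (h₁ : ∀ (j : ZMod N) (n : ℤ), (n : ZMod N) ≠ j → ∀ x : P⟦n⟧ ⟶ (T j).obj₁, x = 0)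
    (h₃ : ∀ (j : ZMod N) (n : ℤ), (n : ZMod N) ≠ j → ∀ x : P⟦n⟧ ⟶ (T j).obj₃, x = 0)
    {A : GradedModule P} (ε : GHom (piMod P Y) A) (hε : ε.Surj)
    (hker : ∀ (n : ℤ) (x : P⟦n⟧ ⟶ Y), ε.app n x = 0 ↔ ∃ z, x = z ≫ f) :
    ∃ X : Presentation P N, Nonempty (GIso (piMod P X.T.obj₃) A) := by
  have hdist : productTriangle T ∈ distTriang C := productTriangle_distinguished T hT
  have inj' : ∀ (n : ℤ) (x : P⟦n⟧ ⟶ ∏ᶜ fun j => (T j).obj₁),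
      x ≫ Limits.Pi.map (fun j => (T j).mor₁) = 0 → x = 0 := by
    intro n x hx
    have : x ≫ e₁.inv = 0 := inj n _ (by
      rw [← cancel_mono e₂.hom, Category.assoc, Category.assoc, ← comm, e₁.inv_hom_id_assoc, hx,
        zero_comp])
    rw [← cancel_mono e₁.inv, this, zero_comp]
  let Z : Presentation P N :=
    { T := productTriangle T
      dist := hdist
      good₁ := good₁.of_retract e₁.inv e₁.hom e₁.inv_hom_id
      good₂ := good₂.of_retract e₂.inv e₂.hom e₂.inv_hom_id
      proj₁ := proj₁.of_iso e₁
      proj₂ := proj₂.of_iso e₂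
      inj := inj'
      split₁ := productSplitting (fun j => (T j).obj₁) h₁
      split₃ := productSplitting (fun j => (T j).obj₃) h₃
      comm := fun i => by
        change factorProj (fun j => (T j).obj₃) i ≫
          (Limits.Pi.map (fun j => (T j).mor₃) ≫ inv (piComparison (shiftFunctor C (1 : ℤ)) _)) =
          (Limits.Pi.map (fun j => (T j).mor₃) ≫ inv (piComparison (shiftFunctor C (1 : ℤ)) _)) ≫
            (factorProj (fun j => (T j).obj₁) i)⟦(1 : ℤ)⟧'
        rw [← cancel_mono (piComparison (shiftFunctor C (1 : ℤ)) _)]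
        refine Pi.hom_ext _ _ fun j => ?_
        simp only [Category.assoc, IsIso.inv_hom_id, Category.comp_id, piComparison_comp_π,
          Limits.Pi.map_π, ← Functor.map_comp, factorProj_π]
        rw [reassoc_of% (factorProj_π (fun j => (T j).obj₃) i j)]
        split_ifs
        · have hinv : inv (piComparison (shiftFunctor C (1 : ℤ)) fun j => (T j).obj₁) ≫
              (Pi.π (fun j => (T j).obj₁) j)⟦(1 : ℤ)⟧' = Pi.π _ j := by
            rw [IsIso.inv_comp_eq, piComparison_comp_π]
          rw [hinv, Limits.Pi.map_π]
        · rw [Functor.map_zero, zero_comp, comp_zero, comp_zero]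
      orth := factorProj_comp _ }
  let m₁ : (∏ᶜ fun j => (T j).obj₁) ⟶ ∏ᶜ fun j => (T j).obj₂ :=
    Limits.Pi.map fun j => (T j).mor₁
  let m₂ : (∏ᶜ fun j => (T j).obj₂) ⟶ ∏ᶜ fun j => (T j).obj₃ :=
    Limits.Pi.map fun j => (T j).mor₂
  have hm : e₁.hom ≫ m₁ = f ≫ e₂.hom := comm
  have h12 : m₁ ≫ m₂ = 0 := Z.zero₁₂
  have lift₂ : ∀ (n : ℤ) (x : P⟦n⟧ ⟶ ∏ᶜ fun j => (T j).obj₃),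
      ∃ y : P⟦n⟧ ⟶ ∏ᶜ fun j => (T j).obj₂, x = y ≫ m₂ := fun n x => Z.exists_lift_mor₂ x
  have lift₁ : ∀ (n : ℤ) (x : P⟦n⟧ ⟶ ∏ᶜ fun j => (T j).obj₂), x ≫ m₂ = 0 →
      ∃ y : P⟦n⟧ ⟶ ∏ᶜ fun j => (T j).obj₁, x = y ≫ m₁ :=
    fun n x hx => Triangle.coyoneda_exact₂ _ Z.dist x hx
  refine ⟨Z, GIso.nonempty_of_surj (piGHom P (e₂.hom ≫ m₂)) ε ?_ hε ?_⟩
  · intro n x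
    obtain ⟨y, hy⟩ := lift₂ n x
    refine ⟨y ≫ e₂.inv, Eq.trans ?_ hy.symm⟩
    change (y ≫ e₂.inv) ≫ e₂.hom ≫ m₂ = y ≫ m₂
    rw [Category.assoc, e₂.inv_hom_id_assoc]
  · intro n x
    rw [hker]
    change x ≫ e₂.hom ≫ m₂ = 0 ↔ _
    constructor
    · intro hx
      obtain ⟨y, hy⟩ := lift₁ n (x ≫ e₂.hom) (by rw [Category.assoc, hx])
      refine ⟨y ≫ e₁.inv, ?_⟩
      rw [← cancel_mono e₂.hom, Category.assoc, Category.assoc, ← hm, e₁.inv_hom_id_assoc]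
      exact hy
    · rintro ⟨z, rfl⟩
      rw [Category.assoc, ← reassoc_of% hm, h12, comp_zero, comp_zero]

variable [HasCoproducts.{v} C]

theorem exists_presentation (hP : IsCompactObj P) (hsp : Sparse P N) {A : GradedModule P}
    (hA : projDimLE 1 A) : ∃ X : Presentation P N, Nonempty (GIso (piMod P X.T.obj₃) A) := by
  obtain ⟨F, K, ε, ι, hF, hS, hK⟩ := hA
  obtain ⟨X, hX, ⟨θ⟩⟩ := hP.exists_realization (Q := K) hK
  obtain ⟨Y, hY, ⟨η⟩⟩ := hP.exists_realization hF
  have hθ : ∀ n x, θ.inv.app n (θ.hom.app n x) = x := fun n x => GHom.congr_app θ.hom_inv_id x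
  have hθ' : ∀ n x, θ.hom.app n (θ.inv.app n x) = x := fun n x => GHom.congr_app θ.inv_hom_id x
  have hη : ∀ n x, η.inv.app n (η.hom.app n x) = x := fun n x => GHom.congr_app η.hom_inv_id x
  have hη' : ∀ n x, η.hom.app n (η.inv.app n x) = x := fun n x => GHom.congr_app η.inv_hom_id x
  obtain ⟨f, hf⟩ := hX.exists_hom ((η.inv.comp ι).comp θ.hom)
  have hf' : ∀ (n : ℤ) (x : P⟦n⟧ ⟶ X), η.hom.app n (x ≫ f) = ι.app n (θ.hom.app n x) := by
    intro n x
    rw [hf]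
    exact hη' _ _
  have inj : ∀ (n : ℤ) (x : P⟦n⟧ ⟶ X), x ≫ f = 0 → x = 0 := by
    intro n x hx
    rw [← hθ n x]
    have := hf' n x
    rw [hx, map_zero] at this
    rw [hS.mono n (this.symm.trans (map_zero _).symm), map_zero]
  obtain ⟨D⟩ := hX.nonempty_decomposition hsp
  obtain ⟨E⟩ := hY.nonempty_decomposition hsp
  choose Z q δ hT using fun j => distinguished_cocone_triangle (D.a j ≫ f ≫ E.b j)
  have inj' : ∀ (j : ZMod N) (n : ℤ) (x : P⟦n⟧ ⟶ D.Y j), x ≫ D.a j ≫ f ≫ E.b j = 0 → x = 0 := by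
    intro j n x hx
    by_cases hn : (n : ZMod N) = j
    · subst hn
      have h0 : (x ≫ D.a _) ≫ f = 0 := by
        rw [← E.b_a_self n ((x ≫ D.a _) ≫ f)]
        simp only [Category.assoc]
        rw [reassoc_of% hx, zero_comp]
      rw [← Category.comp_id x, ← D.a_b, ← Category.assoc, inj n _ h0, zero_comp]
    · exact D.eq_zero hn x
  refine exists_presentation_of_triangles hT f (D.iso hX) (E.iso hY) ?_ hX hY
    (IsProjective.of_retract hK θ.hom θ.inv hθ) (hF.of_retract η.hom η.inv hη) inj
    (fun j n hn x => D.eq_zero hn x) ?_ (ε.comp η.hom) ?_ ?_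
  · refine Pi.hom_ext _ _ fun j => ?_
    rw [Category.assoc, Limits.Pi.map_π, Category.assoc]
    change (D.iso hX).hom ≫ Pi.π D.Y j ≫ D.a j ≫ f ≫ E.b j = f ≫ (E.iso hY).hom ≫ Pi.π E.Y j
    rw [← Category.assoc, D.iso_hom_π, E.iso_hom_π, D.comp_b E hX]
  · intro j n hn x
    obtain ⟨y, hy⟩ := Triangle.coyoneda_exact₃ _ (hT j) x (comp_mor₃_eq_zero (hT j) (inj' j) x)
    change x = y ≫ q j at hy
    rw [hy, E.eq_zero hn y]
    exact zero_comp
  · intro n x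
    obtain ⟨y, rfl⟩ := hS.epi n x
    exact ⟨η.inv.app n y, by rw [GHom.comp_app, hη']⟩
  · intro n x
    rw [GHom.comp_app, hS.exact]
    constructor
    · rintro ⟨k, hk⟩
      refine ⟨θ.inv.app n k, ?_⟩
      rw [← hη n x, ← hk, ← hη n (θ.inv.app n k ≫ f), hf', hθ']
    · rintro ⟨z, rfl⟩
      exact ⟨θ.hom.app n z, (hf' n z).symm⟩

end ProductPresentation

section Unshift

variable {P : C}

theorem Good.shift {X : C} (hX : Good P X) : Good P (X⟦(1 : ℤ)⟧) := by
  apply good_of_exists hX.piFaithful.shift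
  intro Y F
  obtain ⟨g, hg⟩ := hX.exists_deg_hom ((piShift P X).post F)
  refine ⟨g, fun n x => ?_⟩
  obtain ⟨y, rfl⟩ := (piShift_bijective P X (show n - 1 + 1 = n by omega)).2 x
  rw [← piDeg_app, hg, DegHom.post_app]

variable (P)

/-- The inverse of `piShift`. -/
noncomputable def piUnshift (X : C) :
    DegHom (piMod P (X⟦(1 : ℤ)⟧)) (piMod P X) (-1) where
  app {n m} h := (AddEquiv.ofBijective ((piShift P X).app (show m + 1 = n by omega))
    (piShift_bijective P X _)).symm.toAddMonoidHom
  app_smul {n k l n' l'} h h₁ h₂ h₃ x a := by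
    obtain ⟨y, rfl⟩ := (piShift_bijective P X (show n' + 1 = n by omega)).2 x
    apply (piShift_bijective P X (show l' + 1 = l by omega)).1
    refine ((AddEquiv.ofBijective _ (piShift_bijective P X _)).apply_symm_apply _).trans ?_
    rw [(piShift P X).app_smul h₃ (show n' + 1 = n by omega) (show l' + 1 = l by omega) h]
    refine congrArg (fun z => (piMod P _).smul _ z a) (congrArg _ ?_)
    exact ((AddEquiv.ofBijective _ (piShift_bijective P X _)).symm_apply_apply y).symm

variable {P}

@[simp] theorem piUnshift_piShift {X : C} {n m : ℤ} (h : n + -1 = m) (h' : m + 1 = n)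
    (x : P⟦m⟧ ⟶ X) : (piUnshift P X).app h ((piShift P X).app h' x) = x :=
  (AddEquiv.ofBijective _ (piShift_bijective P X h')).symm_apply_apply x

theorem IsProjective.shift {X : C} (hX : IsProjective (piMod P X)) :
    IsProjective (piMod P (X⟦(1 : ℤ)⟧)) := by
  intro A B e he f
  obtain ⟨g, hg⟩ := hX.exists_degHom_lift (s := 1) (t := 0) (a := 1) rfl e.toDeg
    ((piShift P X).post f) (by
      intro n m l hm hl x
      obtain rfl : l = m := by omega
      exact he _ _)
  refine ⟨⟨fun n => (g.app (show n - 1 + 1 = n by omega)).comp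
    ((piUnshift P X).app (show n + -1 = n - 1 by omega)), ?_⟩, ?_⟩
  · intro n k l h x a
    simp only [AddMonoidHom.comp_apply]
    rw [(piUnshift P X).app_smul h _ _ (show n - 1 + k = l - 1 by omega),
      g.app_smul _ _ _ h]
  · ext n x
    obtain ⟨y, rfl⟩ := (piShift_bijective P X (show n - 1 + 1 = n by omega)).2 x
    change e.app n (g.app _ ((piUnshift P X).app _ ((piShift P X).app _ y))) = _
    rw [piUnshift_piShift]
    exact hg (show n - 1 + 1 = n by omega) _ (add_zero n) y

end Unshift

section ToDerived

variable {P : C} {N : ℕ} [NeZero N]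

/-- The projection of a product onto the first factor. -/
def prodFst (K L : GradedModule P) : GHom (K.prod L) K where
  app n := AddMonoidHom.fst _ _
  app_smul _ _ _ := rfl

/-- The projection of a product onto the second factor. -/
def prodSnd (K L : GradedModule P) : GHom (K.prod L) L where
  app n := AddMonoidHom.snd _ _
  app_smul _ _ _ := rfl

namespace Presentation

/-- The degree `-1` homomorphism of projective modules underlying a presentation. -/
noncomputable def res (X : Presentation P N) :
    DegHom (piMod P (X.T.obj₁⟦(1 : ℤ)⟧)) (piMod P X.T.obj₂) (-1) :=
  (piUnshift P X.T.obj₁).post (piGHom P X.T.mor₁)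

theorem res_piShift (X : Presentation P N) {n m : ℤ} (h : n + -1 = m) (h' : m + 1 = n)
    (x : P⟦m⟧ ⟶ X.T.obj₁) : X.res.app h ((piShift P X.T.obj₁).app h' x) = x ≫ X.T.mor₁ := by
  rw [res, DegHom.post_app, piUnshift_piShift, piGHom_app]

theorem res_injective (X : Presentation P N) {n m : ℤ} (h : n + -1 = m)
    (x : P⟦n⟧ ⟶ X.T.obj₁⟦(1 : ℤ)⟧) (hx : X.res.app h x = 0) : x = 0 := by
  have h' : m + 1 = n := by omega
  obtain ⟨y, rfl⟩ := (piShift_bijective P X.T.obj₁ h').2 x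
  rw [res_piShift] at hx
  rw [X.inj m y hx, map_zero]

theorem res_comp {X Y : Presentation P N} (f : X ⟶ Y) {n m : ℤ} (h : n + -1 = m)
    (x : P⟦n⟧ ⟶ X.T.obj₁⟦(1 : ℤ)⟧) :
    Y.res.app h (x ≫ f.f₁⟦(1 : ℤ)⟧') = (X.res.app h x : P⟦m⟧ ⟶ X.T.obj₂) ≫ f.f₂ := by
  have h' : m + 1 = n := by omega
  obtain ⟨y, rfl⟩ := (piShift_bijective P X.T.obj₁ h').2 x
  rw [← piShift_comp, res_piShift, res_piShift, Category.assoc, Category.assoc, f.comm]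

/-- The DG module associated with a presentation. -/
noncomputable abbrev dg (X : Presentation P N) : DGMod P := twoStep X.res

/-- The morphism of DG modules associated with a morphism of presentations. -/
noncomputable def dgMap {X Y : Presentation P N} (f : X ⟶ Y) : X.dg ⟶ Y.dg :=
  twoStepDesc X.res (M := Y.dg)
    ((prodInr _ _).comp (piGHom P f.f₂))
    ((prodInl _ _).comp (piGHom P (f.f₁⟦(1 : ℤ)⟧')) + (prodInr _ _).comp (piGHom P f.u))
    (fun h l => by
      change (twoStep Y.res).dd.app h (0, _) = 0
      rw [twoStep_dd, map_zero]
      rfl)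
    (fun h k => by
      change (twoStep Y.res).dd.app h ((_, 0) + (0, _)) = (0, _)
      rw [map_add, twoStep_dd, twoStep_dd, map_zero]
      refine Prod.ext (add_zero _) ((add_zero _).trans ?_)
      exact res_comp f h k)

theorem dgMap_app {X Y : Presentation P N} (f : X ⟶ Y) {n : ℤ} (k : P⟦n⟧ ⟶ X.T.obj₁⟦(1 : ℤ)⟧)
    (l : P⟦n⟧ ⟶ X.T.obj₂) :
    (dgMap f).g.app n (k, l) = (k ≫ f.f₁⟦(1 : ℤ)⟧', k ≫ f.u + l ≫ f.f₂) := by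
  refine Prod.ext ?_ ?_
  · change (k ≫ f.f₁⟦(1 : ℤ)⟧' + 0) + 0 = _
    rw [add_zero, add_zero]
  · change (0 + k ≫ f.u) + l ≫ f.f₂ = _
    rw [zero_add]

variable (P N)

/-- The functor sending a presentation to its DG module. -/
noncomputable def toDG : Presentation P N ⥤ DGMod P where
  obj X := X.dg
  map f := dgMap f
  map_id X := by
    apply DGHom.ext
    rintro n ⟨k, l⟩
    refine (dgMap_app _ k l).trans (Prod.ext ?_ ?_)
    · change k ≫ (𝟙 X.T.obj₁)⟦(1 : ℤ)⟧' = k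
      rw [CategoryTheory.Functor.map_id, Category.comp_id]
    · change k ≫ 0 + l ≫ 𝟙 X.T.obj₂ = l
      rw [comp_zero, zero_add, Category.comp_id]
  map_comp f g := by
    apply DGHom.ext
    rintro n ⟨k, l⟩
    refine (dgMap_app _ k l).trans (Eq.trans ?_
      ((congrArg ((dgMap g).g.app n) (dgMap_app f k l)).trans (dgMap_app g _ _)).symm)
    simp [add_assoc]

variable {P N}

theorem exists_dgMap_eq {X Y : Presentation P N} (φ : X.dg ⟶ Y.dg) : ∃ f : X ⟶ Y, dgMap f = φ := by
  let ψ : GHom ((piMod P (X.T.obj₁⟦(1 : ℤ)⟧)).prod (piMod P X.T.obj₂))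
    ((piMod P (Y.T.obj₁⟦(1 : ℤ)⟧)).prod (piMod P Y.T.obj₂)) := φ.g
  obtain ⟨α, hα⟩ := X.good₁.shift.exists_hom (((prodFst _ _).comp ψ).comp (prodInl _ _))
  obtain ⟨γ, hγ⟩ := X.good₁.shift.exists_hom (((prodSnd _ _).comp ψ).comp (prodInl _ _))
  obtain ⟨δ, hδ⟩ := X.good₂.exists_hom (((prodSnd _ _).comp ψ).comp (prodInr _ _))
  obtain ⟨f₁, rfl⟩ := (shiftFunctor C (1 : ℤ)).map_surjective α
  have hr : ∀ (n : ℤ) (l : P⟦n⟧ ⟶ X.T.obj₂), φ.g.app n (0, l) = (0, l ≫ δ) := by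
    intro n l
    refine Prod.ext ?_ (hδ n l).symm
    have h0 := twoStep_inr_cycle X.res φ (show n + -1 = n - 1 by omega) l
    exact Y.res_injective (show n + -1 = n - 1 by omega) _ (congrArg Prod.snd h0)
  have hl : ∀ (n : ℤ) (k : P⟦n⟧ ⟶ X.T.obj₁⟦(1 : ℤ)⟧),
      φ.g.app n (k, 0) = (k ≫ f₁⟦(1 : ℤ)⟧', k ≫ γ) :=
    fun n k => Prod.ext (hα n k).symm (hγ n k).symm
  have comm : X.T.mor₁ ≫ δ = f₁ ≫ Y.T.mor₁ := by
    apply X.good₁.piFaithful.ext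
    intro n z
    have h0 := φ.comm_dd (show n + 1 + -1 = n by omega) ((piShift P X.T.obj₁).app rfl z, 0)
    have h1 : φ.g.app n (0, z ≫ X.T.mor₁) =
        Y.dg.dd.app (show n + 1 + -1 = n by omega)
          ((piShift P X.T.obj₁).app rfl z ≫ f₁⟦(1 : ℤ)⟧', (piShift P X.T.obj₁).app rfl z ≫ γ) := by
      rw [← hl, ← h0]
      refine congrArg (φ.g.app n) (Prod.ext rfl ?_)
      exact (X.res_piShift (show n + 1 + -1 = n by omega) rfl z).symm
    rw [hr] at h1
    have h2 := congrArg Prod.snd h1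
    change (z ≫ X.T.mor₁) ≫ δ = Y.res.app _ ((piShift P X.T.obj₁).app _ z ≫ f₁⟦(1 : ℤ)⟧') at h2
    rw [← piShift_comp, res_piShift, Category.assoc, Category.assoc] at h2
    exact h2
  refine ⟨⟨f₁, δ, γ, comm⟩, DGHom.ext ?_⟩
  rintro n ⟨k, l⟩
  refine (dgMap_app _ k l).trans ?_
  have : ((k, l) : (X.dg.gm).M n) = (k, 0) + (0, l) := Prod.ext (add_zero _).symm (zero_add _).symm
  rw [this, map_add, hl, hr]
  exact Prod.ext (add_zero _).symm rfl

theorem dgMap_homotopic_of_rel {X Y : Presentation P N} {f g : X ⟶ Y} (h : Rel f g) :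
    DGHomotopic (dgMap f) (dgMap g) := by
  obtain ⟨h₁, h₂, k₁, e₂, e₁, eu⟩ := h
  let H : DegHom X.dg.gm Y.dg.gm 1 :=
    (((piShift P Y.T.obj₁).pre (piGHom P k₁)).post (prodInl _ _)).coprod
      ((((piShift P Y.T.obj₁).pre (piGHom P h₁)).post (prodInl _ _)) +
        (piDeg P h₂).post (prodInr _ _))
  have hH : ∀ {n m : ℤ} (h : n + 1 = m) (k : P⟦n⟧ ⟶ X.T.obj₁⟦(1 : ℤ)⟧) (x : P⟦n⟧ ⟶ X.T.obj₂),
      H.app h (k, x) = ((piShift P Y.T.obj₁).app h (k ≫ k₁) + (piShift P Y.T.obj₁).app h (x ≫ h₁),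
        (piShift P X.T.obj₂).app h x ≫ h₂) := by
    intro n m h k x
    refine Prod.ext ?_ ?_
    · exact congrArg (_ + ·) (add_zero _)
    · exact (zero_add _).trans (zero_add _)
  refine ⟨H, ?_⟩
  rintro n m l h h' h'' h₃' ⟨k, x⟩
  obtain ⟨z, hz⟩ : ∃ z : P⟦l⟧ ⟶ X.T.obj₁, (piShift P X.T.obj₁).app h₃' z = k :=
    (piShift_bijective P X.T.obj₁ h₃').2 k
  have hk : (X.res.app h'' k : P⟦l⟧ ⟶ X.T.obj₂) = z ≫ X.T.mor₁ := by
    rw [← hz, res_piShift]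
  have hk' : (X.dg.dd.app h'' (k, x) : X.dg.gm.M l) = (0, z ≫ X.T.mor₁) := Prod.ext rfl hk
  rw [dgMap_app, dgMap_app, hk', hH, hH]
  have hE₁ : (k ≫ f.f₁⟦(1 : ℤ)⟧' : P⟦n⟧ ⟶ Y.T.obj₁⟦(1 : ℤ)⟧) - k ≫ g.f₁⟦(1 : ℤ)⟧' =
      (piShift P Y.T.obj₁).app h₃' ((z ≫ X.T.mor₁) ≫ h₁) := by
    rw [← hz, ← piShift_comp, ← piShift_comp, ← map_sub, ← Preadditive.comp_sub, e₁,
      Category.assoc]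
  have hE₂ : (k ≫ f.u + x ≫ f.f₂ : P⟦n⟧ ⟶ Y.T.obj₂) - (k ≫ g.u + x ≫ g.f₂) =
      (k ≫ k₁) ≫ Y.T.mor₁ + (x ≫ h₁) ≫ Y.T.mor₁ +
        (piShift P X.T.obj₂).app h₃' (z ≫ X.T.mor₁) ≫ h₂ := by
    rw [piShift_comp, hz, add_sub_add_comm, ← Preadditive.comp_sub, ← Preadditive.comp_sub, eu, e₂,
      Preadditive.comp_add]
    simp only [Category.assoc]
    abel
  refine Prod.ext (hE₁.trans ?_) (hE₂.trans ?_)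
  · change _ = 0 + ((piShift P Y.T.obj₁).app h₃' (0 ≫ k₁) + _)
    rw [zero_comp, map_zero, zero_add, zero_add]
  · change _ = Y.res.app h' (_ + _) + _
    rw [map_add, res_piShift, res_piShift]

theorem rel_of_dgMap_homotopic {X Y : Presentation P N} {f g : X ⟶ Y}
    (h : DGHomotopic (dgMap f) (dgMap g)) : Rel f g := by
  obtain ⟨H, hH⟩ := h
  let H' : DegHom ((piMod P (X.T.obj₁⟦(1 : ℤ)⟧)).prod (piMod P X.T.obj₂))
    ((piMod P (Y.T.obj₁⟦(1 : ℤ)⟧)).prod (piMod P Y.T.obj₂)) 1 := H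
  obtain ⟨α, hα⟩ := X.good₁.shift.exists_deg_hom ((H'.post (prodFst _ _)).pre (prodInl _ _))
  obtain ⟨β, hβ⟩ := X.good₂.exists_deg_hom ((H'.post (prodFst _ _)).pre (prodInr _ _))
  obtain ⟨δ, hδ⟩ := X.good₂.exists_deg_hom ((H'.post (prodSnd _ _)).pre (prodInr _ _))
  obtain ⟨k₁, rfl⟩ := (shiftFunctor C (1 : ℤ)).map_surjective α
  obtain ⟨h₁, rfl⟩ := (shiftFunctor C (1 : ℤ)).map_surjective β
  have hα' : ∀ {n m : ℤ} (h : n + 1 = m) (k : P⟦n⟧ ⟶ X.T.obj₁⟦(1 : ℤ)⟧),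
      (H.app h (k, 0)).1 = (piShift P Y.T.obj₁).app h (k ≫ k₁) := by
    intro n m h k
    rw [piShift_comp, ← piDeg_app, hα]
    rfl
  have hβ' : ∀ {n m : ℤ} (h : n + 1 = m) (x : P⟦n⟧ ⟶ X.T.obj₂),
      H.app h (0, x) = ((piShift P Y.T.obj₁).app h (x ≫ h₁), (piDeg P δ).app h x) := by
    intro n m h k
    rw [piShift_comp, ← piDeg_app, hβ, hδ]
    rfl
  have e0 : ∀ {n m l : ℤ} (h : n + 1 = m) (h' : m + -1 = n) (h'' : n + -1 = l)
      (h₃' : l + 1 = n) (k : P⟦n⟧ ⟶ X.T.obj₁⟦(1 : ℤ)⟧) (x : P⟦n⟧ ⟶ X.T.obj₂),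
      ((k ≫ f.f₁⟦(1 : ℤ)⟧' - k ≫ g.f₁⟦(1 : ℤ)⟧',
          (k ≫ f.u + x ≫ f.f₂) - (k ≫ g.u + x ≫ g.f₂)) : Y.dg.gm.M n) =
        Y.dg.dd.app h' (H.app h (k, x)) + H.app h₃' (0, X.res.app h'' k) := by
    intro n m l h h' h'' h₃' k x
    refine Eq.trans ?_ (hH h h' h'' h₃' (k, x))
    rw [dgMap_app, dgMap_app]
    rfl
  have e1 : ∀ {n m l : ℤ} (h : n + 1 = m) (h' : m + -1 = n) (h'' : n + -1 = l)
      (h₃' : l + 1 = n) (k : P⟦n⟧ ⟶ X.T.obj₁⟦(1 : ℤ)⟧),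
      k ≫ f.f₁⟦(1 : ℤ)⟧' - k ≫ g.f₁⟦(1 : ℤ)⟧' =
        (piShift P Y.T.obj₁).app h₃' ((X.res.app h'' k : P⟦l⟧ ⟶ X.T.obj₂) ≫ h₁) := by
    intro n m l h h' h'' h₃' k
    refine (congrArg Prod.fst (e0 h h' h'' h₃' k 0)).trans ?_
    rw [hβ']
    exact zero_add _
  have e2 : ∀ {n m l : ℤ} (h : n + 1 = m) (h' : m + -1 = n) (h'' : n + -1 = l)
      (h₃' : l + 1 = n) (x : P⟦n⟧ ⟶ X.T.obj₂), x ≫ f.f₂ - x ≫ g.f₂ = x ≫ h₁ ≫ Y.T.mor₁ := by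
    intro n m l h h' h'' h₃' x
    have h1 := congrArg Prod.snd (e0 h h' h'' h₃' 0 x)
    rw [map_zero, hβ', hβ', map_zero] at h1
    have h2 : (0 ≫ f.u + x ≫ f.f₂) - (0 ≫ g.u + x ≫ g.f₂) =
      Y.res.app h' ((piShift P Y.T.obj₁).app h (x ≫ h₁)) + 0 := h1
    rw [res_piShift] at h2
    simpa using h2
  have e3 : ∀ {n m l : ℤ} (h : n + 1 = m) (h' : m + -1 = n) (h'' : n + -1 = l)
      (h₃' : l + 1 = n) (k : P⟦n⟧ ⟶ X.T.obj₁⟦(1 : ℤ)⟧), k ≫ f.u - k ≫ g.u =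
        k ≫ k₁ ≫ Y.T.mor₁ +
          (piShift P X.T.obj₂).app h₃' (X.res.app h'' k : P⟦l⟧ ⟶ X.T.obj₂) ≫ δ := by
    intro n m l h h' h'' h₃' k
    have h1 := congrArg Prod.snd (e0 h h' h'' h₃' k 0)
    rw [hβ'] at h1
    have h2 : (k ≫ f.u + 0 ≫ f.f₂) - (k ≫ g.u + 0 ≫ g.f₂) =
      Y.res.app h' (H.app h (k, 0)).1 +
        (piShift P X.T.obj₂).app h₃' (X.res.app h'' k : P⟦l⟧ ⟶ X.T.obj₂) ≫ δ := h1
    rw [hα', res_piShift] at h2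
    simpa using h2
  refine ⟨h₁, δ, k₁, ?_, ?_, ?_⟩
  · apply X.good₂.piFaithful.ext
    intro n x
    rw [Preadditive.comp_sub]
    exact e2 (n := n) rfl (by omega) rfl (by omega) x
  · apply X.good₁.piFaithful.ext
    intro n z
    apply (piShift_bijective P _ (rfl : n + 1 = n + 1)).1
    rw [Preadditive.comp_sub, map_sub, piShift_comp, piShift_comp,
      e1 rfl (by omega) (show n + 1 + -1 = n by omega) rfl, res_piShift, Category.assoc]
  · apply X.good₁.shift.piFaithful.ext
    intro n k
    obtain ⟨z, rfl⟩ := (piShift_bijective P X.T.obj₁ (show n - 1 + 1 = n by omega)).2 k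
    rw [Preadditive.comp_sub, e3 (n := n) rfl (by omega) (show n + -1 = n - 1 by omega) (by omega),
      res_piShift, piShift_comp, Preadditive.comp_add, Category.assoc]

end Presentation

end ToDerived

section Realization

variable {P : C}

/-- The cycles of a DG module as a graded submodule. -/
def DGMod.cyclesSub (M : DGMod P) : GSub M.gm where
  S n := (M.dd.app (show n + -1 = n - 1 by omega)).ker
  smul_mem {n k l} h x a hx := by
    rw [AddMonoidHom.mem_ker] at hx ⊢
    rw [M.dd.app_smul h (show n + -1 = n - 1 by omega) _ (show n - 1 + k = l - 1 by omega), hx]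
    exact M.gm.zero_smulₓ _ a

theorem DGMod.dd_eq_zero_of_cyclesSub (M : DGMod P) {n m : ℤ} (h : n + -1 = m)
    (x : M.cyclesSub.toMod.M n) : M.dd.app h x.1 = 0 := by
  obtain rfl : n - 1 = m := by omega
  exact x.2

/-- The boundaries of a DG module as a graded submodule of the cycles. -/
def DGMod.boundariesSub (M : DGMod P) : GSub M.cyclesSub.toMod where
  S n := (M.dd.app (show n + 1 + -1 = n by omega)).range.comap (M.cyclesSub.S n).subtype
  smul_mem {n k l} h x a := by
    rintro ⟨w, hw⟩
    refine ⟨M.gm.smul (show n + 1 + k = l + 1 by omega) w a, ?_⟩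
    rw [M.dd.app_smul _ (show n + 1 + -1 = n by omega) _ h, hw]
    rfl

/-- The homology of a DG module as a graded module. -/
abbrev DGMod.homologyMod (M : DGMod P) : GradedModule P := M.boundariesSub.quot

/-- The inclusion of a graded submodule. -/
def GSub.incl {M : GradedModule P} (S : GSub M) : GHom S.toMod M where
  app n := (S.S n).subtype
  app_smul _ _ _ := rfl

namespace Presentation

variable {N : ℕ} [NeZero N]

theorem exists_quasiIso (X : Presentation P N) (M : DGMod P)
    (e : GIso (piMod P X.T.obj₃) M.homologyMod) : ∃ φ : X.dg ⟶ M, quasiIso P φ := by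
  have he : ∀ n x, e.inv.app n (e.hom.app n x) = x := fun n x => GHom.congr_app e.hom_inv_id x
  have he' : ∀ n x, e.hom.app n (e.inv.app n x) = x := fun n x => GHom.congr_app e.inv_hom_id x
  let ρ : GHom (piMod P X.T.obj₂) M.homologyMod := e.hom.comp (piGHom P X.T.mor₂)
  have hρ : ∀ n x, ∃ y, ρ.app n y = x := by
    intro n x
    obtain ⟨y, hy⟩ := X.exists_lift_mor₂ (e.inv.app n x)
    refine ⟨y, ?_⟩
    change e.hom.app n (y ≫ X.T.mor₂) = x
    rw [← hy]
    exact he' n x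
  have hρ₀ : ∀ (n : ℤ) (x : P⟦n⟧ ⟶ X.T.obj₁), ρ.app n (x ≫ X.T.mor₁) = 0 := by
    intro n x
    change e.hom.app n ((x ≫ X.T.mor₁) ≫ X.T.mor₂) = 0
    rw [Category.assoc, X.zero₁₂, comp_zero]
    exact map_zero _
  have hρ₁ : ∀ (n : ℤ) (x : P⟦n⟧ ⟶ X.T.obj₂), ρ.app n x = 0 →
      ∃ z : P⟦n⟧ ⟶ X.T.obj₁, x = z ≫ X.T.mor₁ := by
    intro n x hx
    apply Triangle.coyoneda_exact₂ _ X.dist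
    refine (he n (x ≫ X.T.mor₂)).symm.trans ?_
    exact (congrArg (e.inv.app n) hx).trans (map_zero _)
  obtain ⟨ζ, hζ⟩ := X.proj₂.exists_lift M.boundariesSub.proj ρ
    (fun n x => QuotientAddGroup.mk_surjective _)
  let x : GHom (piMod P X.T.obj₂) M.gm := M.cyclesSub.incl.comp ζ
  have hx : ∀ {n m : ℤ} (h : n + -1 = m) (l : P⟦n⟧ ⟶ X.T.obj₂), M.dd.app h (x.app n l) = 0 :=
    fun h l => M.dd_eq_zero_of_cyclesSub h _
  have hb : ∀ {n m : ℤ} (h : m + -1 = n) (z : M.cyclesSub.toMod.M n),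
      M.boundariesSub.proj.app n z = 0 ↔ ∃ w, M.dd.app h w = z.1 := by
    intro n m h z
    obtain rfl : n + 1 = m := by omega
    exact GSub.proj_eq_zero _ _
  obtain ⟨y, hy⟩ := X.proj₁.shift.exists_degHom_lift (s := -1) (t := -1) (a := 0) rfl M.dd
    (X.res.post x) (by
      intro n m l hm hl k
      obtain ⟨z, rfl⟩ := (piShift_bijective P X.T.obj₁ (show m + 1 = n by omega)).2 k
      rw [DegHom.post_app, res_piShift]
      exact (hb hl _).1 ((hζ _ _).trans (hρ₀ _ _)))
  have hy' : ∀ {n m : ℤ} (h : n + -1 = m) (k : P⟦n⟧ ⟶ X.T.obj₁⟦(1 : ℤ)⟧),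
      M.dd.app h (y.toGHom.app n k) = x.app m (X.res.app h k) := fun h k => hy h _ h k
  let φ : X.dg ⟶ M := twoStepDesc X.res x y.toGHom hx hy'
  have hφ : ∀ (n : ℤ) (l : P⟦n⟧ ⟶ X.T.obj₂), φ.g.app n (0, l) = x.app n l := fun n l =>
    (congrArg (· + x.app n l) (map_zero (y.toGHom.app n))).trans (zero_add _)
  refine ⟨φ, ?_⟩
  rw [quasiIso_iff]
  constructor
  · intro n m l h h' z hz
    obtain rfl : n - 1 = m := by omega
    let z' : M.cyclesSub.toMod.M n := ⟨z, hz⟩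
    obtain ⟨l₀, hl₀⟩ := hρ n (M.boundariesSub.proj.app n z')
    refine ⟨(0, l₀), ?_, ?_⟩
    · rw [twoStep_dd, map_zero]
      rfl
    · rw [hφ]
      refine (hb h' (ζ.app n l₀ - z')).1 ?_
      rw [map_sub, hζ, hl₀, sub_self]
  · rintro n m l h h' ⟨k, l₀⟩ w hk hw
    change P⟦n⟧ ⟶ X.T.obj₂ at l₀
    have hk0 : k = 0 := X.res_injective h k (congrArg Prod.snd hk)
    subst hk0
    rw [hφ] at hw
    obtain ⟨z, hz⟩ := hρ₁ n l₀ ((hζ _ _).symm.trans ((hb h' _).2 ⟨w, hw⟩))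
    refine ⟨((piShift P X.T.obj₁).app (show n + 1 = l by omega) z, 0), ?_⟩
    refine Prod.ext rfl ?_
    rw [hz]
    exact X.res_piShift h' _ z

variable (P N)

/-- The functor from presentations to the derived category. -/
noncomputable def toDerived : Presentation P N ⥤ DerivedCat P := toDG P N ⋙ (quasiIso P).Q

variable {P N}

theorem localization_hom (X : Presentation P N) (M : DGMod P) :
    (∀ φ : (quasiIso P).Q.obj X.dg ⟶ (quasiIso P).Q.obj M,
      ∃ a : X.dg ⟶ M, (quasiIso P).Q.map a = φ) ∧
    ∀ a b : X.dg ⟶ M, (quasiIso P).Q.map a = (quasiIso P).Q.map b ↔ DGHomotopic a b :=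
  twoStep_localization_hom X.res X.proj₁.shift X.proj₂ M

theorem toDerived_map_eq_iff {X Y : Presentation P N} (f g : X ⟶ Y) :
    (toDerived P N).map f = (toDerived P N).map g ↔ Rel f g :=
  ((localization_hom X Y.dg).2 (dgMap f) (dgMap g)).trans
    ⟨rel_of_dgMap_homotopic, dgMap_homotopic_of_rel⟩

instance toDerived_full : (toDerived P N).Full where
  map_surjective {X Y} φ := by
    obtain ⟨a, rfl⟩ := (localization_hom X Y.dg).1 φ
    obtain ⟨f, rfl⟩ := exists_dgMap_eq a
    exact ⟨f, rfl⟩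

theorem toDerived_essSurj (hex : ∀ A : GradedModule P, ∃ X : Presentation P N,
    Nonempty (GIso (piMod P X.T.obj₃) A)) : (toDerived P N).EssSurj where
  mem_essImage D := by
    obtain ⟨M, ⟨i⟩⟩ : ∃ M, Nonempty ((quasiIso P).Q.obj M ≅ D) :=
      ⟨_, ⟨(quasiIso P).Q.objObjPreimageIso D⟩⟩
    obtain ⟨X, ⟨e⟩⟩ := hex M.homologyMod
    obtain ⟨φ, hφ⟩ := X.exists_quasiIso M e
    exact ⟨X, ⟨Localization.isoOfHom (quasiIso P).Q (quasiIso P) φ hφ ≪≫ i⟩⟩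

end Presentation

end Realization

/-- Let `P` be a compact generator of the triangulated category `C`
whose graded endomorphism ring `Λ = End_T(P)_*` is `N`-sparse for some `N ≥ 2` and has
graded global homological dimension exactly `1`. Then `C` is equivalent, as a
category, to the derived category `D(Λ)` of DG right `Λ`-modules, i.e. the
localization of the category of DG right `Λ`-modules at the quasi-isomorphisms. -/
theorem statement_12 [IsTriangulated C] [HasCoproducts.{v} C]
    (P : C) (hcpt : IsCompactObj P) (hgen : IsGenerator P)
    (N : ℕ) (hN : 2 ≤ N) (hsp : Sparse P N)
    (hgl_le : ∀ M : GradedModule P, projDimLE 1 M)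
    (hgl_ge : ¬ ∀ M : GradedModule P, projDimLE 0 M) :
    Nonempty (C ≌ DerivedCat P) := by
  have : NeZero N := ⟨by omega⟩
  have : Fact (1 < N) := ⟨by omega⟩
  have hex := fun A : GradedModule P => exists_presentation (N := N) hcpt hsp (hgl_le A)
  have := Presentation.toC_essSurj hgen hex
  have := Presentation.toDerived_essSurj hex
  exact nonempty_equivalence_of_full_essSurj (Presentation.toC P N) (Presentation.toDerived P N)
    fun f g => (Presentation.toC_map_eq_iff f g).trans (Presentation.toDerived_map_eq_iff f g).symm

end Franke
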